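/- arXiv:2307.09453 — 2 statements merged into one kernel-verified Lean document; each statement's English description precedes it below -/
import Mathlib

section
/- Let N ≥ 3 be odd, S = {1,…,N−1}, V = F^S with standard basis (e_s)_{s in S}, and <.,.> the alternating bilinear form determined by <e_i,e_j> = 1 iff |i−j| = 1, so that (S,E) is a path of type A_{N−1}. Then the triple (V,<.,.>,(e_s)) is perfect. -/
/-- The induced subgraph of `adj` on `I` is a path (type `A_m`, `m ≥ 1`):
there is an injective enumeration `f : Fin (m+1) → S` of `I` such that two
elements of `I` are adjacent iff they are consecutive in the enumeration. -/
def IsPathOn {S : Type} [DecidableEq S] (adj : S → S → Prop) (I : Finset S) : Prop :=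
  ∃ (m : ℕ) (f : Fin (m + 1) → S), Function.Injective f ∧
    I = Finset.image f Finset.univ ∧
    ∀ i j : Fin (m + 1), adj (f i) (f j) ↔ ((i : ℕ) + 1 = (j : ℕ) ∨ (j : ℕ) + 1 = (i : ℕ))

/-- The induced subgraph of `adj` on `I` is connected. -/
def ConnOn {S : Type} (adj : S → S → Prop) (I : Finset S) : Prop :=
  ∀ s ∈ I, ∀ t ∈ I, Relation.ReflTransGen (fun a b => a ∈ I ∧ b ∈ I ∧ adj a b) s t

/-- `I ∈ Cal_I^1`: the induced subgraph on `I` is a path and `|I|` is odd. -/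
def CalI1 {S : Type} [DecidableEq S] (adj : S → S → Prop) (I : Finset S) : Prop :=
  IsPathOn adj I ∧ Odd I.card

/-- `I ≺ I'`. -/
def Prec {S : Type} [DecidableEq S] (adj : S → S → Prop) (I I' : Finset S) : Prop :=
  I ⊂ I' ∧ ¬ ConnOn adj (I' \ I)

/-- `I ♠ I'`. -/
def Spade {S : Type} [DecidableEq S] (adj : S → S → Prop) (I I' : Finset S) : Prop :=
  I ∩ I' = ∅ ∧ ¬ ConnOn adj (I ∪ I')

/-- `I^{ev}`: the set of `s ∈ I` such that `I ∖ {s}` is the disjoint union of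
`I', I'' ∈ Cal_I^1` with `I' ♠ I''`. -/
def Iev {S : Type} [DecidableEq S] (adj : S → S → Prop) (I : Finset S) : Set S :=
  {s | s ∈ I ∧ ∃ I' I'' : Finset S, CalI1 adj I' ∧ CalI1 adj I'' ∧
    Spade adj I' I'' ∧ I.erase s = I' ∪ I''}

/-- Property (P0). -/
def P0 {S : Type} [DecidableEq S] (adj : S → S → Prop) (B : Finset (Finset S)) : Prop :=
  ∀ I ∈ B, ∀ I' ∈ B, I = I' ∨ Spade adj I I' ∨ Prec adj I I' ∨ Prec adj I' I

/-- Property (P1). -/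
def P1 {S : Type} [DecidableEq S] (adj : S → S → Prop) (B : Finset (Finset S)) : Prop :=
  ∀ I ∈ B, ∃ (k : ℕ) (f : Fin k → Finset S),
    (∀ j, f j ∈ B ∧ Prec adj (f j) I) ∧
    (∀ j j', j ≠ j' → Disjoint (f j) (f j')) ∧
    Iev adj I ⊆ ⋃ j, ((f j : Finset S) : Set S)

/-- `phi`: finite sets `B` of elements of `Cal_I^1` satisfying (P0) and (P1). -/
def phiSet {S : Type} [DecidableEq S] (adj : S → S → Prop) : Set (Finset (Finset S)) :=
  {B | (∀ I ∈ B, CalI1 adj I) ∧ P0 adj B ∧ P1 adj B}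

/-- `supp(B)`. -/
def suppB {S : Type} [DecidableEq S] (B : Finset (Finset S)) : Finset S := B.biUnion id

/-- `g_s(B)`. -/
def gs {S : Type} [DecidableEq S] (B : Finset (Finset S)) (s : S) : ℕ :=
  (B.filter (fun I => s ∈ I)).card

/-- `e_I = ∑_{s ∈ I} e_s`. -/
def eSum {S : Type} {V : Type} [AddCommGroup V] [Module (ZMod 2) V]
    (e : S → V) (I : Finset S) : V := ∑ s ∈ I, e s

/-- `L_B`: the `F`-span of `{e_I : I ∈ B}`. -/
def LB {S : Type} {V : Type} [AddCommGroup V] [Module (ZMod 2) V]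
    (e : S → V) (B : Finset (Finset S)) : Submodule (ZMod 2) V :=
  Submodule.span (ZMod 2) ((fun I => eSum e I) '' (B : Set (Finset S)))

/-- `eps(B) = ∑_{s ∈ S} ((g_s(B)(g_s(B)+1)/2) mod 2) e_s`. -/
def epsB {S : Type} [DecidableEq S] [Fintype S] {V : Type} [AddCommGroup V]
    [Module (ZMod 2) V] (e : S → V) (B : Finset (Finset S)) : V :=
  ∑ s : S, ((gs B s * (gs B s + 1) / 2 : ℕ) : ZMod 2) • e s

/-- The triple `(V, <,>, e)` (with graph `adj`) is perfect. -/
def IsPerfect {S : Type} [DecidableEq S] [Fintype S] {V : Type} [AddCommGroup V]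
    [Module (ZMod 2) V] (adj : S → S → Prop) (e : S → V) : Prop :=
  (∀ B ∈ phiSet adj,
      (LinearIndependent (ZMod 2) (fun I : {I : Finset S // I ∈ B} => eSum e I.1)) ∧
      (∀ I : Finset S, CalI1 adj I → (eSum e I ∈ LB e B ↔ I ∈ B))) ∧
  (∀ B ∈ phiSet adj, epsB e B ∈ LB e B) ∧
  Set.BijOn (epsB e) (phiSet adj) (⋃ B ∈ phiSet adj, ((LB e B : Submodule (ZMod 2) V) : Set V)) ∧
  (∀ B ∈ phiSet adj, ∀ B' ∈ phiSet adj, epsB e B' ∈ LB e B → ∀ s : S, gs B' s ≤ gs B s)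
/-- Adjacency of the cycle of length `N` on `S = ZMod N`. -/
def cadj (N : ℕ) (i j : ZMod N) : Prop := j = i + 1 ∨ i = j + 1

/-- `V = F^S` for `S = ZMod N`. -/
abbrev Vc (N : ℕ) := ZMod N → ZMod 2

/-- The standard basis vector `e_s`. -/
def eVec (N : ℕ) (s : ZMod N) : Vc N := Pi.single s 1

/-- The line `F·e_S`, where `e_S = ∑_{s ∈ S} e_s`. -/
def radN (N : ℕ) [NeZero N] : Submodule (ZMod 2) (Vc N) :=
  Submodule.span (ZMod 2) {eSum (eVec N) Finset.univ}

/-- `Vbar = V / (F·e_S)`. -/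
abbrev VbarN (N : ℕ) [NeZero N] := Vc N ⧸ radN N

/-- The quotient map `pi : V → Vbar`. -/
def piQ (N : ℕ) [NeZero N] : Vc N →ₗ[ZMod 2] VbarN N := (radN N).mkQ

/-- `ebar_s = pi(e_s)`. -/
def ebar (N : ℕ) [NeZero N] (s : ZMod N) : VbarN N := piQ N (eVec N s)
open scoped Classical in
/-- The connected component of `s` in the induced subgraph of `adj` on `I`. -/
noncomputable def compOf {S : Type} [DecidableEq S] (adj : S → S → Prop)
    (I : Finset S) (s : S) : Finset S :=
  I.filter (fun t => Relation.ReflTransGen (fun a b => a ∈ I ∧ b ∈ I ∧ adj a b) s t)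

/-- `c(I)`: the set of vertex sets of connected components of the induced subgraph on `I`. -/
noncomputable def comps {S : Type} [DecidableEq S] (adj : S → S → Prop)
    (I : Finset S) : Finset (Finset S) :=
  I.image (compOf adj I)

/-- `|c^0(I)|`: the number of connected components of even cardinality. -/
noncomputable def c0card {S : Type} [DecidableEq S] (adj : S → S → Prop)
    (I : Finset S) : ℕ :=
  ((comps adj I).filter (fun C => Even C.card)).card

/-- `V_0 = {e_I : I ⊊ S with |c^0(I)| even}`. -/
def V0set (N : ℕ) [NeZero N] : Set (Vc N) :=
  {v | ∃ I : Finset (ZMod N), I ≠ Finset.univ ∧ Even (c0card (cadj N) I) ∧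
    v = eSum (eVec N) I}

/-- `V_1 = {e_S} ∪ {e_I : ∅ ≠ I ⊊ S with |c^0(I)| odd}`. -/
def V1set (N : ℕ) [NeZero N] : Set (Vc N) :=
  {v | v = eSum (eVec N) Finset.univ ∨ ∃ I : Finset (ZMod N), I ≠ ∅ ∧ I ≠ Finset.univ ∧
    Odd (c0card (cadj N) I) ∧ v = eSum (eVec N) I}
open scoped Classical in
/-- `I^{odd} = I ∖ I^{ev}` (as a `Finset`). -/
noncomputable def IoddF {S : Type} [DecidableEq S] (adj : S → S → Prop)
    (I : Finset S) : Finset S :=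
  I.filter (fun s => s ∉ Iev adj I)

/-- `n_B = |{I ∈ B : ee ⊆ I}|`. -/
def nB {S : Type} [DecidableEq S] (ee : Finset S) (B : Finset (Finset S)) : ℕ :=
  (B.filter (fun I => ee ⊆ I)).card

open scoped Classical in
/-- `B ↦ B^!`: remove the unique `I_B ∈ B` with `|I_B ∩ ee| = 1` when `n_B` is odd;
leave `B` unchanged when `n_B` is even. -/
noncomputable def bangF {S : Type} [DecidableEq S] (ee : Finset S)
    (B : Finset (Finset S)) : Finset (Finset S) :=
  if h : Odd (nB ee B) ∧ ∃ I ∈ B, (I ∩ ee).card = 1 then B.erase h.2.choose else B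

/-- `omega = {B^! : B ∈ phi}`. -/
def omegaSet {S : Type} [DecidableEq S] (adj : S → S → Prop) (ee : Finset S) :
    Set (Finset (Finset S)) :=
  (bangF ee) '' (phiSet adj)

open scoped Classical in
/-- `Btilde`: the unique element of `phi` with `Btilde^! = B`. -/
noncomputable def tildeF {S : Type} [DecidableEq S] (adj : S → S → Prop) (ee : Finset S)
    (C : Finset (Finset S)) : Finset (Finset S) :=
  if h : ∃ B ∈ phiSet adj, bangF ee B = C then h.choose else ∅

/-- `'eps(B) = eps(Btilde)`. -/
noncomputable def epsO {S : Type} [DecidableEq S] [Fintype S] {V : Type} [AddCommGroup V]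
    [Module (ZMod 2) V] (adj : S → S → Prop) (ee : Finset S) (e : S → V)
    (C : Finset (Finset S)) : V :=
  epsB e (tildeF adj ee C)

/-- `B' ⪯ B` on `omega`. -/
def preceqO {S : Type} [DecidableEq S] [Fintype S] {V : Type} [AddCommGroup V]
    [Module (ZMod 2) V] (adj : S → S → Prop) (ee : Finset S) (e : S → V)
    (B' B : Finset (Finset S)) : Prop :=
  ∃ (k : ℕ) (c : ℕ → Finset (Finset S)), c 0 = B' ∧ c k = B ∧
    (∀ i ≤ k, c i ∈ omegaSet adj ee) ∧
    (∀ i < k, epsO adj ee e (c i) ∈ LB e (c (i + 1)))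

/-- The linear form `v ↦ v t + v t'` on `V`. -/
def zeeV (N : ℕ) (t t' : ZMod N) : Vc N →ₗ[ZMod 2] ZMod 2 :=
  (LinearMap.proj t : Vc N →ₗ[ZMod 2] ZMod 2) + (LinearMap.proj t' : Vc N →ₗ[ZMod 2] ZMod 2)

/-- `z_ee : Vbar → F`, the linear map with `z_ee(ebar_s) = 1` iff `s ∈ ee = {t,t'}`. -/
noncomputable def zee (N : ℕ) [NeZero N] (t t' : ZMod N) : VbarN N →ₗ[ZMod 2] ZMod 2 :=
  Submodule.liftQ (radN N) (zeeV N t t') (by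
    rw [radN, Submodule.span_le, Set.singleton_subset_iff]
    have h1 : ∀ u : ZMod N, (eSum (eVec N) Finset.univ) u = 1 := by
      intro u
      simp [eSum, eVec, Finset.sum_apply, Finset.sum_pi_single]
    simp only [SetLike.mem_coe, LinearMap.mem_ker, zeeV, LinearMap.add_apply,
      LinearMap.proj_apply, h1]
    decide)
/-- The maximal elements of a finite family of finsets, under inclusion. -/
def maxElts {S : Type} [DecidableEq S] (C : Finset (Finset S)) : Finset (Finset S) :=
  C.filter (fun I => ∀ I' ∈ C, ¬ I ⊂ I')

/-- `restB B k = B ∖ (B_1 ∪ … ∪ B_k)`: what remains of `B` after removing the first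
`k` layers; the `k`-th layer (`k ≥ 1`) is `B_k = maxElts (restB B (k-1))`. -/
def restB {S : Type} [DecidableEq S] (B : Finset (Finset S)) : ℕ → Finset (Finset S)
  | 0 => B
  | k + 1 => restB B k \ maxElts (restB B k)

/-- The relation `B' ≤ B` on `phi(V)`. -/
def lePhi {S : Type} [DecidableEq S] [Fintype S] {V : Type} [AddCommGroup V]
    [Module (ZMod 2) V] (adj : S → S → Prop) (e : S → V)
    (B' B : Finset (Finset S)) : Prop :=
  ∃ (k : ℕ) (c : ℕ → Finset (Finset S)), c 0 = B' ∧ c k = B ∧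
    (∀ i ≤ k, c i ∈ phiSet adj) ∧
    (∀ i < k, epsB e (c i) ∈ LB e (c (i + 1)))

namespace PathPerfect

/-- Adjacency of the path graph on `Fin n`. -/
def padj (n : ℕ) (i j : Fin n) : Prop := (i : ℕ) + 1 = (j : ℕ) ∨ (j : ℕ) + 1 = (i : ℕ)

/-- The step relation of the height walks: up, down, or flat at height zero. -/
def Rst (k l : ℕ) : Prop := l = k + 1 ∨ k = l + 1 ∨ (k = 0 ∧ l = 0)

/-- Triangular number modulo two. -/
def Ep (k : ℕ) : ZMod 2 := ((k * (k + 1) / 2 : ℕ) : ZMod 2)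

theorem Ep_zero : Ep 0 = 0 := by simp [Ep]

theorem Ep_one : Ep 1 = 1 := by simp [Ep]

theorem Ep_add_two (k : ℕ) : Ep (k + 2) = Ep k + 1 := by
  have h : (k + 2) * (k + 2 + 1) / 2 = k * (k + 1) / 2 + (2 * (k + 1) + 1) := by
    have : (k + 2) * (k + 2 + 1) = k * (k + 1) + 2 * (2 * (k + 1) + 1) := by ring
    omega
  unfold Ep
  rw [h]
  push_cast
  have h2 : (2 : ZMod 2) = 0 := by decide
  rw [h2]; ring

theorem zmod2_cases (x : ZMod 2) : x = 0 ∨ x = 1 := by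
  revert x; decide

theorem zmod2_ne {x y : ZMod 2} (h : x ≠ y) : x + 1 = y := by
  revert x y; decide

theorem zmod2_succ_ne (x : ZMod 2) : x + 1 ≠ x := by
  revert x; decide

theorem Rst_det {k l l' : ℕ} (h : Rst k l) (h' : Rst k l') (he : Ep l = Ep l') : l = l' := by
  have key : ∀ m, Ep (m + 2) ≠ Ep m := fun m => by
    rw [Ep_add_two]; exact zmod2_succ_ne _
  have h01 : Ep 0 ≠ Ep 1 := by rw [Ep_zero, Ep_one]; decide
  rcases h with h | h | ⟨h, h2⟩ <;> rcases h' with h' | h' | ⟨h', h2'⟩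
  · omega
  · exfalso; subst h; subst h'; exact key _ he
  · subst h; subst h2'; subst h'; exact absurd he.symm h01
  · exfalso; subst h; obtain rfl : l' = l + 2 := by omega
    exact key _ he.symm
  · omega
  · omega
  · subst h'; subst h2; subst h; exact absurd he h01
  · omega
  · omega

theorem Rst_ex (k : ℕ) (x : ZMod 2) : ∃ l, Rst k l ∧ Ep l = x := by
  rcases k with _ | m
  · rcases zmod2_cases x with rfl | rfl
    · exact ⟨0, by simp [Rst], Ep_zero⟩
    · exact ⟨1, by simp [Rst], Ep_one⟩
  · by_cases h : Ep m = x
    · exact ⟨m, by simp [Rst], h⟩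
    · exact ⟨m + 2, by simp [Rst], by rw [Ep_add_two]; exact zmod2_ne h⟩

theorem Rst_symm {k l : ℕ} (h : Rst k l) : Rst l k := by
  unfold Rst at *; omega

/-- Height walks. -/
structure IsW (n : ℕ) (g : ℕ → ℕ) : Prop where
  g0 : g 0 = 0
  gn : g (n + 1) = 0
  st : ∀ p ≤ n, Rst (g p) (g (p + 1))

theorem ivt_left {n : ℕ} {g : ℕ → ℕ} (st : ∀ p ≤ n, Rst (g p) (g (p + 1))) {a m : ℕ} (ha : g a ≤ m) :
    ∀ p, a ≤ p → p ≤ n + 1 → m < g p →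
      ∃ c, a ≤ c ∧ c < p ∧ g c = m ∧ ∀ q, c < q → q ≤ p → m < g q := by
  intro p hp
  induction p, hp using Nat.le_induction with
  | base => intro _ h; omega
  | succ p hp ih =>
    intro hpn hm
    by_cases h : m < g p
    · obtain ⟨c, h1, h2, h3, h4⟩ := ih (by omega) h
      refine ⟨c, h1, by omega, h3, fun q hq hq' => ?_⟩
      rcases Nat.lt_or_ge p q with h5 | h5
      · obtain rfl : q = p + 1 := by omega
        exact hm
      · exact h4 q hq h5
    · have hs := st p (by omega)
      refine ⟨p, hp, by omega, ?_, fun q hq hq' => ?_⟩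
      · unfold Rst at hs; omega
      · obtain rfl : q = p + 1 := by omega
        exact hm

theorem ivt_right {n : ℕ} {g : ℕ → ℕ} (st : ∀ p ≤ n, Rst (g p) (g (p + 1))) {b m : ℕ}
    (hbn : b ≤ n + 1) (hb : g b ≤ m) {p : ℕ} (hp : p ≤ b) (hm : m < g p) :
      ∃ d, p < d ∧ d ≤ b ∧ g d = m ∧ ∀ q, p ≤ q → q < d → m < g q := by
  classical
  have hex : ∃ d, p ≤ d ∧ g d ≤ m := ⟨b, hp, hb⟩
  have h1 := Nat.find_spec hex
  have h2 : Nat.find hex ≤ b := Nat.find_min' hex ⟨hp, hb⟩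
  have h3 : ∀ q, p ≤ q → q < Nat.find hex → m < g q := by
    intro q hq hq'
    have := Nat.find_min hex hq'
    by_contra h
    exact this ⟨hq, by omega⟩
  generalize Nat.find hex = d at *
  have hpd : p < d := by
    rcases Nat.lt_or_ge p d with h | h
    · exact h
    · obtain rfl : p = d := by omega
      omega
  refine ⟨d, hpd, h2, ?_, h3⟩
  have h4 := h3 (d - 1) (by omega) (by omega)
  have h5 := st (d - 1) (by omega)
  rw [show d - 1 + 1 = d by omega] at h5
  unfold Rst at h5; omega

/-- Valid excursions of a height walk. -/
def Val (n : ℕ) (g : ℕ → ℕ) (a b : ℕ) : Prop :=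
  a + 2 ≤ b ∧ b ≤ n + 1 ∧ g a = g b ∧ ∀ p, a < p → p < b → g a < g p

/-- Class constancy. -/
def CC (n : ℕ) (g : ℕ → ℕ) (v : ℕ → ZMod 2) : Prop :=
  ∀ i j, i ≤ j → j ≤ n + 1 → g i = g j → (∀ q, i ≤ q → q ≤ j → g i ≤ g q) → v i = v j

/-- The main comparison. -/
theorem walk_le {n : ℕ} {g h : ℕ → ℕ} (hg : IsW n g) (h0 : h 0 = 0)
    (hst : ∀ p ≤ n, Rst (h p) (h (p + 1))) (hc : CC n g (fun p => Ep (h p))) :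
    ∀ s ≤ n + 1, h s ≤ g s := by
  suffices H : ∀ s ≤ n + 1, h s ≤ g s ∧
      ∀ i ≤ s, g i = g s → (∀ q, i ≤ q → q ≤ s → g i ≤ g q) → h i = h s from
    fun s hs => (H s hs).1
  intro s
  induction s using Nat.strong_induction_on with
  | _ s ih =>
  intro hs
  rcases s with _ | s
  · refine ⟨by omega, fun i hi _ _ => ?_⟩
    obtain rfl : i = 0 := by omega
    rfl
  have ihs := ih s (by omega) (by omega)
  have hs1 := hst s (by omega)
  rcases hg.st s (by omega) with hu | hd | ⟨hz, hz'⟩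
  · refine ⟨by unfold Rst at hs1; omega, fun i hi hgi hq => ?_⟩
    rcases Nat.lt_or_ge i (s + 1) with h1 | h1
    · have := hq s (by omega) (by omega)
      omega
    · obtain rfl : i = s + 1 := by omega
      rfl
  · obtain ⟨c, -, hcs, hgc, hcq⟩ := ivt_left hg.st (a := 0) (m := g (s + 1)) (by rw [hg.g0]; omega)
      s (by omega) (by omega) (by omega)
    have e1 : h (c + 1) = h s := by
      refine ihs.2 (c + 1) (by omega) ?_ ?_
      · have h2 := hcq (c + 1) (by omega) (by omega)
        have h3 := hg.st c (by omega)
        unfold Rst at h3; omega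
      · intro q h1 h2
        have h2 := hcq q (by omega) (by omega)
        have h3 := hg.st c (by omega)
        unfold Rst at h3; omega
    have e2 : Ep (h c) = Ep (h (s + 1)) := by
      refine hc c (s + 1) (by omega) hs hgc ?_
      intro q h1 h2
      rcases Nat.lt_or_ge c q with h3 | h3
      · rcases Nat.lt_or_ge s q with h4 | h4
        · obtain rfl : q = s + 1 := by omega
          omega
        · have := hcq q h3 h4
          omega
      · obtain rfl : q = c := by omega
        exact le_rfl
    have e3 : h c = h (s + 1) := by
      have h3 := hst c (by omega)
      rw [e1] at h3
      exact Rst_det (Rst_symm h3) hs1 e2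
    have ihc := ih c (by omega) (by omega)
    refine ⟨by omega, fun i hi hgi hq => ?_⟩
    rcases Nat.lt_or_ge i (s + 1) with h1 | h1
    · have h4 : i ≤ c := by
        by_contra h5
        have := hcq i (by omega) (by omega)
        omega
      rw [← e3]
      exact ihc.2 i h4 (by omega) (fun q h5 h6 => hq q h5 (by omega))
    · obtain rfl : i = s + 1 := by omega
      rfl
  · have e2 : Ep (h s) = Ep (h (s + 1)) := by
      refine hc s (s + 1) (by omega) hs (by omega) ?_
      intro q h1 h2
      omega
    have e0 : h s = 0 := by omega
    have e1 : h (s + 1) = 0 := by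
      refine (Rst_det (k := 0) (Or.inr (Or.inr ⟨rfl, rfl⟩)) (by rwa [e0] at hs1) ?_).symm
      rwa [e0] at e2
    refine ⟨by omega, fun i hi hgi _ => ?_⟩
    rcases Nat.lt_or_ge i (s + 1) with h1 | h1
    · have := (ih i h1 (by omega)).1
      omega
    · obtain rfl : i = s + 1 := by omega
      rfl

theorem walk_ex (v : ℕ → ZMod 2) (hv : v 0 = 0) :
    ∃ h : ℕ → ℕ, h 0 = 0 ∧ (∀ p, Rst (h p) (h (p + 1))) ∧ ∀ p, Ep (h p) = v p := by
  choose F hF1 hF2 using Rst_ex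
  let h : ℕ → ℕ := fun p => Nat.rec 0 (fun p k => F k (v (p + 1))) p
  refine ⟨h, rfl, fun p => hF1 _ _, fun p => ?_⟩
  rcases p with _ | p
  · rw [hv]; exact Ep_zero
  · exact hF2 _ _

theorem walk_unique {n : ℕ} {g h : ℕ → ℕ} (hg : IsW n g) (hh : IsW n h)
    (he : ∀ p ≤ n + 1, Ep (g p) = Ep (h p)) : ∀ p ≤ n + 1, g p = h p := by
  intro p
  induction p with
  | zero => intro _; rw [hg.g0, hh.g0]
  | succ p ih =>
    intro hp
    have e := ih (by omega)
    have h1 := hg.st p (by omega)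
    have h2 := hh.st p (by omega)
    rw [← e] at h2
    exact Rst_det h1 h2 (he _ hp)

theorem Val_tri {n : ℕ} {g : ℕ → ℕ} {a b c d : ℕ} (h : Val n g a b) (h' : Val n g c d) :
    (a = c ∧ b = d) ∨ b ≤ c ∨ d ≤ a ∨ (c < a ∧ b < d ∧ g c < g a) ∨ (a < c ∧ d < b ∧ g a < g c) := by
  obtain ⟨h1, h2, h3, h4⟩ := h
  obtain ⟨k1, k2, k3, k4⟩ := h'
  have x1 := h4 c
  have x2 := h4 d
  have y1 := k4 a
  have y2 := k4 b
  by_cases hac : a = c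
  · subst hac
    omega
  · by_cases hbd : b = d
    · subst hbd
      omega
    · omega

theorem Val_parity {n : ℕ} {g : ℕ → ℕ} (st : ∀ p ≤ n, Rst (g p) (g (p + 1))) {a b : ℕ}
    (h : Val n g a b) : ∀ q, a ≤ q → q ≤ b → (g q + g a + q + a) % 2 = 0 := by
  obtain ⟨h1, h2, h3, h4⟩ := h
  intro q hq
  induction q, hq using Nat.le_induction with
  | base => intro _; omega
  | succ q hq ih =>
    intro hqb
    have := ih (by omega)
    have hs := st q (by omega)
    have x1 := h4 q
    have x2 := h4 (q + 1)
    have : ¬ (g q = 0 ∧ g (q + 1) = 0) := by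
      rintro ⟨e1, e2⟩
      rcases Nat.lt_or_ge a q with h5 | h5
      · have := x1 h5 (by omega); omega
      · have := x2 (by omega) (by omega); omega
    unfold Rst at hs
    omega

end PathPerfect
namespace PathPerfect

/-- The open interval `(a,b)` of positions, where vertex `s` has position `s+1`. -/
def iv (n a b : ℕ) : Finset (Fin n) :=
  Finset.univ.filter (fun s => a < (s : ℕ) + 1 ∧ (s : ℕ) + 1 < b)

theorem mem_iv {n a b : ℕ} {s : Fin n} : s ∈ iv n a b ↔ a < (s : ℕ) + 1 ∧ (s : ℕ) + 1 < b := by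
  simp [iv]

/-- Admissible pairs of endpoints. -/
def ok (n a b : ℕ) : Prop := a + 2 ≤ b ∧ b ≤ n + 1 ∧ (b - a) % 2 = 0

theorem exists_fin {n p : ℕ} (h : 0 < p) (h' : p ≤ n) : ∃ s : Fin n, (s : ℕ) + 1 = p :=
  ⟨⟨p - 1, by omega⟩, by simp; omega⟩

theorem iv_inj {n a b c d : ℕ} (h : a + 2 ≤ b) (hb : b ≤ n + 1) (h' : c + 2 ≤ d) (hd : d ≤ n + 1)
    (e : iv n a b = iv n c d) : a = c ∧ b = d := by
  have key : ∀ p, 0 < p → p ≤ n → ((a < p ∧ p < b) ↔ (c < p ∧ p < d)) := by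
    intro p h1 h2
    obtain ⟨s, rfl⟩ := exists_fin h1 h2
    rw [← mem_iv, ← mem_iv, e]
  have k1 := key (a + 1) (by omega) (by omega)
  have k2 := key (c + 1) (by omega) (by omega)
  have k3 := key (b - 1) (by omega) (by omega)
  have k4 := key (d - 1) (by omega) (by omega)
  omega

theorem rtg_symm {α : Type} {r : α → α → Prop} (h : ∀ a b, r a b → r b a) {x y : α}
    (hxy : Relation.ReflTransGen r x y) : Relation.ReflTransGen r y x := by
  induction hxy with
  | refl => exact Relation.ReflTransGen.refl
  | tail _ h2 ih => exact Relation.ReflTransGen.head (h _ _ h2) ih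

theorem conn_iff {n : ℕ} {I : Finset (Fin n)} : ConnOn (padj n) I ↔
    ∀ s ∈ I, ∀ t ∈ I, ∀ r : Fin n, s ≤ r → r ≤ t → r ∈ I := by
  constructor
  · intro h s hs t ht r hsr hrt
    have key : ∀ u, Relation.ReflTransGen (fun a b => a ∈ I ∧ b ∈ I ∧ padj n a b) s u →
        u ∈ I ∧ (r ≤ u → r ∈ I) := by
      intro u hu
      induction hu with
      | refl => exact ⟨hs, fun h => by rw [le_antisymm h hsr]; exact hs⟩
      | @tail b c hab hbc ih =>
        obtain ⟨h1, h2, h3⟩ := hbc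
        refine ⟨h2, fun h4 => ?_⟩
        by_cases h5 : r ≤ b
        · exact ih.2 h5
        · have : r = c := by
            apply Fin.ext
            unfold padj at h3
            have h4' : (r : ℕ) ≤ c := h4
            have h5' : ¬ (r : ℕ) ≤ b := h5
            omega
          rw [this]; exact h2
    exact (key t (h s hs t ht)).2 hrt
  · intro h
    have key : ∀ (k : ℕ) (s t : Fin n), s ∈ I → t ∈ I → (s : ℕ) + k = t →
        Relation.ReflTransGen (fun a b => a ∈ I ∧ b ∈ I ∧ padj n a b) s t := by
      intro k
      induction k with
      | zero =>
        intro s t hs ht e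
        have : s = t := Fin.ext (by omega)
        rw [this]
      | succ k ih =>
        intro s t hs ht e
        have ht' := t.isLt
        have hm : (⟨(s : ℕ) + k, by omega⟩ : Fin n) ∈ I :=
          h s hs t ht _ (by rw [Fin.le_def]; simp) (by rw [Fin.le_def]; simp; omega)
        exact (ih s ⟨(s : ℕ) + k, by omega⟩ hs hm rfl).tail
          ⟨hm, ht, Or.inl (by simp; omega)⟩
    intro s hs t ht
    rcases le_total s t with hst | hst
    · exact key ((t : ℕ) - s) s t hs ht (by have : (s : ℕ) ≤ t := hst; omega)
    · have h1 := key ((s : ℕ) - t) t s ht hs (by have : (t : ℕ) ≤ s := hst; omega)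
      refine rtg_symm ?_ h1
      intro a b hab
      exact ⟨hab.2.1, hab.1, hab.2.2.symm⟩

theorem iv_image {n a m : ℕ} (h : a + m + 2 ≤ n + 1) :
    iv n a (a + m + 2) = Finset.image (fun i : Fin (m + 1) => (⟨a + i, by omega⟩ : Fin n))
      Finset.univ := by
  ext s
  simp only [mem_iv, Finset.mem_image, Finset.mem_univ, true_and]
  constructor
  · intro hs
    exact ⟨⟨s - a, by omega⟩, Fin.ext (by simp; omega)⟩
  · rintro ⟨i, rfl⟩
    simp; omega

theorem iv_inj_fun {n a m : ℕ} (h : a + m + 2 ≤ n + 1) :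
    Function.Injective (fun i : Fin (m + 1) => (⟨a + i, by omega⟩ : Fin n)) := by
  intro i j hij
  simp only [Fin.mk.injEq] at hij
  exact Fin.ext (by omega)

theorem iv_card {n a m : ℕ} (h : a + m + 2 ≤ n + 1) : (iv n a (a + m + 2)).card = m + 1 := by
  rw [iv_image h, Finset.card_image_of_injective _ (iv_inj_fun h)]
  simp

theorem path_conn {n : ℕ} {I : Finset (Fin n)} (h : IsPathOn (padj n) I) :
    I.Nonempty ∧ ConnOn (padj n) I := by
  obtain ⟨m, f, hf, rfl, hadj⟩ := h
  refine ⟨⟨f 0, by simp⟩, ?_⟩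
  set I := Finset.image f Finset.univ with hI
  have hm : ∀ i, f i ∈ I := fun i => by simp [hI]
  have hsym : ∀ a b, (a ∈ I ∧ b ∈ I ∧ padj n a b) → (b ∈ I ∧ a ∈ I ∧ padj n b a) :=
    fun a b hab => ⟨hab.2.1, hab.1, hab.2.2.symm⟩
  have key : ∀ (k : ℕ) (hk : k < m + 1),
      Relation.ReflTransGen (fun a b => a ∈ I ∧ b ∈ I ∧ padj n a b) (f 0) (f ⟨k, hk⟩) := by
    intro k
    induction k with
    | zero => intro hk; exact Relation.ReflTransGen.refl
    | succ k ih =>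
      intro hk
      exact (ih (by omega)).tail ⟨hm _, hm _, (hadj _ _).2 (Or.inl rfl)⟩
  intro s hs t ht
  rw [hI, Finset.mem_image] at hs ht
  obtain ⟨i, -, rfl⟩ := hs
  obtain ⟨j, -, rfl⟩ := ht
  exact (rtg_symm hsym (key i i.isLt)).trans (key j j.isLt)

theorem cal_iff {n : ℕ} {I : Finset (Fin n)} :
    CalI1 (padj n) I ↔ ∃ a b, ok n a b ∧ I = iv n a b := by
  constructor
  · rintro ⟨hp, hc⟩
    obtain ⟨hne, hconn⟩ := path_conn hp
    rw [conn_iff] at hconn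
    have e : I = iv n (I.min' hne) ((I.min' hne : ℕ) + ((I.max' hne : ℕ) - I.min' hne) + 2) := by
      ext s
      rw [mem_iv]
      have hle : (I.min' hne : ℕ) ≤ I.max' hne := I.min'_le _ (I.max'_mem hne)
      constructor
      · intro hs
        have h1 : (I.min' hne : ℕ) ≤ s := I.min'_le _ hs
        have h2 : (s : ℕ) ≤ I.max' hne := I.le_max' _ hs
        omega
      · intro hs
        refine hconn _ (I.min'_mem hne) _ (I.max'_mem hne) s ?_ ?_
        · rw [Fin.le_def]; omega
        · rw [Fin.le_def]; omega
    have hlt := (I.max' hne).isLt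
    have hle : (I.min' hne : ℕ) ≤ I.max' hne := I.min'_le _ (I.max'_mem hne)
    have hcard := iv_card (n := n) (a := I.min' hne) (m := (I.max' hne : ℕ) - I.min' hne) (by omega)
    rw [← e] at hcard
    refine ⟨_, _, ⟨?_, ?_, ?_⟩, e⟩
    · omega
    · omega
    · rw [hcard] at hc
      rw [Nat.odd_iff] at hc
      omega
  · rintro ⟨a, b, ⟨h1, h2, h3⟩, rfl⟩
    obtain ⟨m, rfl⟩ : ∃ m, b = a + m + 2 := ⟨b - a - 2, by omega⟩
    refine ⟨⟨m, _, iv_inj_fun h2, iv_image h2, ?_⟩, ?_⟩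
    · intro i j
      simp only [padj]
      omega
    · rw [iv_card h2, Nat.odd_iff]; omega

theorem prec_iff {n a b c d : ℕ} (h : a + 2 ≤ b) (hb : b ≤ n + 1) (h' : c + 2 ≤ d) (hd : d ≤ n + 1) :
    Prec (padj n) (iv n a b) (iv n c d) ↔ c < a ∧ b < d := by
  unfold Prec
  rw [conn_iff]
  constructor
  · rintro ⟨h1, h2⟩
    have key : ∀ p, 0 < p → p ≤ n → ((a < p ∧ p < b) → (c < p ∧ p < d)) := by
      intro p h3 h4
      obtain ⟨s, rfl⟩ := exists_fin h3 h4
      rw [← mem_iv, ← mem_iv]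
      exact fun hs => h1.1 hs
    have k1 := key (a + 1) (by omega) (by omega)
    have k3 := key (b - 1) (by omega) (by omega)
    by_contra hcon
    apply h2
    intro s hs t ht r hsr hrt
    rw [Finset.mem_sdiff, mem_iv, mem_iv] at *
    rw [Fin.le_def] at hsr hrt
    omega
  · intro hcd
    refine ⟨⟨?_, ?_⟩, ?_⟩
    · intro s hs
      rw [mem_iv] at *; omega
    · intro hsub
      obtain ⟨s, hs⟩ := exists_fin (n := n) (p := a) (by omega) (by omega)
      have := hsub (show s ∈ iv n c d by rw [mem_iv]; omega)
      rw [mem_iv] at this; omega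
    · intro hc
      obtain ⟨s, hs⟩ := exists_fin (n := n) (p := a) (by omega) (by omega)
      obtain ⟨t, ht⟩ := exists_fin (n := n) (p := b) (by omega) (by omega)
      obtain ⟨r, hr⟩ := exists_fin (n := n) (p := a + 1) (by omega) (by omega)
      have := hc s (by rw [Finset.mem_sdiff, mem_iv, mem_iv]; omega)
        t (by rw [Finset.mem_sdiff, mem_iv, mem_iv]; omega) r
        (by rw [Fin.le_def]; omega) (by rw [Fin.le_def]; omega)
      rw [Finset.mem_sdiff, mem_iv, mem_iv] at this
      omega

theorem spade_iff {n a b c d : ℕ} (h : a + 2 ≤ b) (hb : b ≤ n + 1) (h' : c + 2 ≤ d)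
    (hd : d ≤ n + 1) : Spade (padj n) (iv n a b) (iv n c d) ↔ b ≤ c ∨ d ≤ a := by
  unfold Spade
  rw [conn_iff]
  constructor
  · rintro ⟨h1, h2⟩
    have key : ∀ p, 0 < p → p ≤ n → ¬ ((a < p ∧ p < b) ∧ (c < p ∧ p < d)) := by
      intro p h3 h4
      obtain ⟨s, rfl⟩ := exists_fin h3 h4
      rw [← mem_iv, ← mem_iv]
      rintro hs
      have : s ∈ iv n a b ∩ iv n c d := Finset.mem_inter.2 hs
      rw [h1] at this
      simp at this
    have k1 := key (a + 1) (by omega) (by omega)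
    have k2 := key (c + 1) (by omega) (by omega)
    by_contra hcon
    apply h2
    intro s hs t ht r hsr hrt
    rw [Finset.mem_union, mem_iv, mem_iv] at *
    rw [Fin.le_def] at hsr hrt
    omega
  · intro hcd
    refine ⟨?_, ?_⟩
    · ext s
      rw [Finset.mem_inter, mem_iv, mem_iv]
      simp only [Finset.notMem_empty, iff_false]
      omega
    · intro hc
      rcases hcd with hcd | hcd
      · obtain ⟨s, hs⟩ := exists_fin (n := n) (p := a + 1) (by omega) (by omega)
        obtain ⟨t, ht⟩ := exists_fin (n := n) (p := c + 1) (by omega) (by omega)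
        obtain ⟨r, hr⟩ := exists_fin (n := n) (p := b) (by omega) (by omega)
        have := hc s (by rw [Finset.mem_union, mem_iv, mem_iv]; omega)
          t (by rw [Finset.mem_union, mem_iv, mem_iv]; omega) r
          (by rw [Fin.le_def]; omega) (by rw [Fin.le_def]; omega)
        rw [Finset.mem_union, mem_iv, mem_iv] at this
        omega
      · obtain ⟨s, hs⟩ := exists_fin (n := n) (p := c + 1) (by omega) (by omega)
        obtain ⟨t, ht⟩ := exists_fin (n := n) (p := a + 1) (by omega) (by omega)
        obtain ⟨r, hr⟩ := exists_fin (n := n) (p := d) (by omega) (by omega)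
        have := hc s (by rw [Finset.mem_union, mem_iv, mem_iv]; omega)
          t (by rw [Finset.mem_union, mem_iv, mem_iv]; omega) r
          (by rw [Fin.le_def]; omega) (by rw [Fin.le_def]; omega)
        rw [Finset.mem_union, mem_iv, mem_iv] at this
        omega

theorem iev_iff {n a b : ℕ} (h : ok n a b) (s : Fin n) :
    s ∈ Iev (padj n) (iv n a b) ↔
      a < (s : ℕ) + 1 ∧ (s : ℕ) + 1 < b ∧ ((s : ℕ) + 1 - a) % 2 = 0 := by
  obtain ⟨h1, h2, h3⟩ := h
  unfold Iev
  simp only [Set.mem_ofPred_eq]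
  constructor
  · rintro ⟨hs, I', I'', hI', hI'', hsp, he⟩
    rw [cal_iff] at hI' hI''
    obtain ⟨c, d, ⟨c1, c2, c3⟩, rfl⟩ := hI'
    obtain ⟨c', d', ⟨c1', c2', c3'⟩, rfl⟩ := hI''
    rw [spade_iff c1 c2 c1' c2'] at hsp
    rw [mem_iv] at hs
    have key : ∀ p, 0 < p → p ≤ n →
        ((p ≠ (s : ℕ) + 1 ∧ a < p ∧ p < b) ↔ ((c < p ∧ p < d) ∨ (c' < p ∧ p < d'))) := by
      intro p h3 h4
      obtain ⟨t, rfl⟩ := exists_fin h3 h4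
      rw [← mem_iv, ← mem_iv, ← mem_iv, ← Finset.mem_union, ← he, Finset.mem_erase, Ne, Ne,
        Fin.ext_iff]
      simp
    refine ⟨hs.1, hs.2, ?_⟩
    have k1 := key (a + 1) (by omega) (by omega)
    have k2 := key (b - 1) (by omega) (by omega)
    have k3 := key (c + 1) (by omega) (by omega)
    have k4 := key (c' + 1) (by omega) (by omega)
    have k5 := key (d - 1) (by omega) (by omega)
    have k6 := key (d' - 1) (by omega) (by omega)
    rcases hsp with hsp | hsp
    · have k7 := key d (by omega) (by omega)
      omega
    · have k7 := key d' (by omega) (by omega)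
      omega
  · rintro ⟨s1, s2, s3⟩
    refine ⟨mem_iv.2 ⟨s1, s2⟩, iv n a ((s : ℕ) + 1), iv n ((s : ℕ) + 1) b, ?_, ?_, ?_, ?_⟩
    · exact cal_iff.2 ⟨_, _, ⟨by omega, by omega, by omega⟩, rfl⟩
    · exact cal_iff.2 ⟨_, _, ⟨by omega, by omega, by omega⟩, rfl⟩
    · exact (spade_iff (by omega) (by omega) (by omega) (by omega)).2 (Or.inl le_rfl)
    · ext t
      rw [Finset.mem_erase, Finset.mem_union, mem_iv, mem_iv, mem_iv, Ne, Fin.ext_iff]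
      omega

end PathPerfect
namespace PathPerfect

/-- `B ∈ phi`, rephrased with intervals. -/
structure PhiF (n : ℕ) (B : Finset (Finset (Fin n))) : Prop where
  cal : ∀ I ∈ B, ∃ a b, ok n a b ∧ I = iv n a b
  tri : ∀ a b c d, ok n a b → ok n c d → iv n a b ∈ B → iv n c d ∈ B →
    (a = c ∧ b = d) ∨ b ≤ c ∨ d ≤ a ∨ (c < a ∧ b < d) ∨ (a < c ∧ d < b)
  cov : ∀ a b p, ok n a b → iv n a b ∈ B → a < p → p < b → (p - a) % 2 = 0 →
    ∃ c d, ok n c d ∧ iv n c d ∈ B ∧ a < c ∧ d < b ∧ c < p ∧ p < d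

theorem phi_facts {n : ℕ} {B : Finset (Finset (Fin n))} (h : B ∈ phiSet (padj n)) : PhiF n B := by
  obtain ⟨h1, h2, h3⟩ := h
  refine ⟨fun I hI => cal_iff.1 (h1 I hI), ?_, ?_⟩
  · intro a b c d o1 o2 m1 m2
    have := h2 _ m1 _ m2
    rw [spade_iff o1.1 o1.2.1 o2.1 o2.2.1, prec_iff o1.1 o1.2.1 o2.1 o2.2.1,
      prec_iff o2.1 o2.2.1 o1.1 o1.2.1] at this
    rcases this with e | h | h | h
    · exact Or.inl (iv_inj o1.1 o1.2.1 o2.1 o2.2.1 e)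
    · tauto
    · tauto
    · tauto
  · intro a b p o1 m1 p1 p2 p3
    obtain ⟨k, f, f1, f2, f3⟩ := h3 _ m1
    have := o1.2.1
    obtain ⟨s, rfl⟩ := exists_fin (n := n) (p := p) (by omega) (by omega)
    have hs := f3 ((iev_iff o1 s).2 ⟨p1, p2, p3⟩)
    rw [Set.mem_iUnion] at hs
    obtain ⟨j, hj⟩ := hs
    obtain ⟨g1, g2⟩ := f1 j
    obtain ⟨c, d, o2, e⟩ := cal_iff.1 (h1 _ g1)
    rw [e] at g1 g2 hj
    rw [prec_iff o2.1 o2.2.1 o1.1 o1.2.1] at g2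
    rw [Finset.mem_coe, mem_iv] at hj
    exact ⟨c, d, o2, g1, g2.1, g2.2, hj.1, hj.2⟩

/-- Members of `B` containing position `p`. -/
def AtP {n : ℕ} (B : Finset (Finset (Fin n))) (p : ℕ) : Finset (Finset (Fin n)) :=
  B.filter (fun I => ∃ s ∈ I, (s : ℕ) + 1 = p)

/-- The height function of `B`. -/
def Gf {n : ℕ} (B : Finset (Finset (Fin n))) (p : ℕ) : ℕ := (AtP B p).card

theorem mem_AtP {n : ℕ} {B : Finset (Finset (Fin n))} {p a b : ℕ} (hb : b ≤ n + 1) :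
    iv n a b ∈ AtP B p ↔ iv n a b ∈ B ∧ a < p ∧ p < b := by
  unfold AtP
  rw [Finset.mem_filter]
  refine and_congr_right fun _ => ?_
  constructor
  · rintro ⟨s, hs, rfl⟩
    exact mem_iv.1 hs
  · intro h
    obtain ⟨s, rfl⟩ := exists_fin (n := n) (p := p) (by omega) (by omega)
    exact ⟨s, mem_iv.2 h, rfl⟩

theorem Gf_gs {n : ℕ} (B : Finset (Finset (Fin n))) (s : Fin n) : gs B s = Gf B ((s : ℕ) + 1) := by
  unfold gs Gf AtP
  congr 1
  apply Finset.filter_congr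
  intro I _
  constructor
  · intro h; exact ⟨s, h, rfl⟩
  · rintro ⟨t, ht, e⟩
    have : t = s := Fin.ext (by omega)
    rwa [← this]

theorem AtP_sub {n : ℕ} {B : Finset (Finset (Fin n))} (hB : PhiF n B) {p q : ℕ}
    (h : ∀ a b, ok n a b → iv n a b ∈ B → a < p → p < b → a < q ∧ q < b) : AtP B p ⊆ AtP B q := by
  intro I hI
  obtain ⟨a, b, o, rfl⟩ := hB.cal I (Finset.mem_filter.1 hI).1
  rw [mem_AtP o.2.1] at *
  exact ⟨hI.1, h a b o hI.1 hI.2.1 hI.2.2⟩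

/-- Starting interval gives an up step. -/
theorem Gf_up {n : ℕ} {B : Finset (Finset (Fin n))} (hB : PhiF n B) {a b : ℕ} (o : ok n a b)
    (m : iv n a b ∈ B) : Gf B (a + 1) = Gf B a + 1 := by
  have e : AtP B (a + 1) = insert (iv n a b) (AtP B a) := by
    apply Finset.Subset.antisymm
    · intro I hI
      obtain ⟨c, d, o', rfl⟩ := hB.cal I (Finset.mem_filter.1 hI).1
      rw [Finset.mem_insert]
      rw [mem_AtP o'.2.1] at *
      have := hB.tri a b c d o o' m hI.1
      by_cases hc : c = a
      · left
        have : d = b := by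
          obtain ⟨x1, x2, x3⟩ := o
          omega
        rw [hc, this]
      · right
        exact ⟨hI.1, by omega, by omega⟩
    · intro I hI
      rw [Finset.mem_insert] at hI
      rcases hI with rfl | hI
      · rw [mem_AtP o.2.1]
        exact ⟨m, by omega, o.1⟩
      · obtain ⟨c, d, o', rfl⟩ := hB.cal I (Finset.mem_filter.1 hI).1
        rw [mem_AtP o'.2.1] at *
        have := hB.tri a b c d o o' m hI.1
        obtain ⟨x1, x2, x3⟩ := o
        exact ⟨hI.1, by omega, by omega⟩
  unfold Gf
  rw [e, Finset.card_insert_of_notMem]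
  rw [mem_AtP o.2.1]
  omega

/-- Ending interval gives a down step. -/
theorem Gf_down {n : ℕ} {B : Finset (Finset (Fin n))} (hB : PhiF n B) {a b : ℕ} (o : ok n a (b + 1))
    (m : iv n a (b + 1) ∈ B) : Gf B b = Gf B (b + 1) + 1 := by
  have e : AtP B b = insert (iv n a (b + 1)) (AtP B (b + 1)) := by
    apply Finset.Subset.antisymm
    · intro I hI
      obtain ⟨c, d, o', rfl⟩ := hB.cal I (Finset.mem_filter.1 hI).1
      rw [Finset.mem_insert]
      rw [mem_AtP o'.2.1] at *
      have := hB.tri a (b + 1) c d o o' m hI.1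
      by_cases hc : d = b + 1
      · left
        have : c = a := by
          obtain ⟨x1, x2, x3⟩ := o
          omega
        rw [hc, this]
      · right
        exact ⟨hI.1, by omega, by omega⟩
    · intro I hI
      rw [Finset.mem_insert] at hI
      obtain ⟨x1, x2, x3⟩ := o
      rcases hI with rfl | hI
      · rw [mem_AtP x2]
        exact ⟨m, by omega, by omega⟩
      · obtain ⟨c, d, o', rfl⟩ := hB.cal I (Finset.mem_filter.1 hI).1
        rw [mem_AtP o'.2.1] at *
        have := hB.tri a (b + 1) c d ⟨x1, x2, x3⟩ o' m hI.1
        exact ⟨hI.1, by omega, by omega⟩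
  unfold Gf
  rw [e, Finset.card_insert_of_notMem]
  rw [mem_AtP o.2.1]
  omega

theorem flat_zero {n : ℕ} {B : Finset (Finset (Fin n))} (hB : PhiF n B) {p : ℕ}
    (h1 : ∀ b, ok n p b → iv n p b ∉ B) (h2 : ∀ a, ok n a (p + 1) → iv n a (p + 1) ∉ B) :
    ∀ (k a b : ℕ), b - a ≤ k → ok n a b → iv n a b ∈ B → a < p → p < b → False := by
  intro k
  induction k with
  | zero => intro a b hk o _ _ _; have := o.1; omega
  | succ k ih =>
    intro a b hk o m ha hb
    have hb' : p + 1 < b := by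
      rcases Nat.lt_or_ge (p + 1) b with h | h
      · exact h
      · obtain rfl : b = p + 1 := by omega
        exact absurd m (h2 a o)
    obtain ⟨q, hq, hqp⟩ : ∃ q, (q = p ∨ q = p + 1) ∧ (q - a) % 2 = 0 := by
      by_cases h : (p - a) % 2 = 0
      · exact ⟨p, Or.inl rfl, h⟩
      · exact ⟨p + 1, Or.inr rfl, by omega⟩
    obtain ⟨c, d, o', m', c1, c2, c3, c4⟩ := hB.cov a b q o m (by omega) (by omega) hqp
    have hc : c ≠ p := by rintro rfl; exact h1 d o' m'
    have hd : d ≠ p + 1 := by rintro rfl; exact h2 c o' m'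
    exact ih c d (by omega) o' m' (by omega) (by omega)

theorem Gf_flat {n : ℕ} {B : Finset (Finset (Fin n))} (hB : PhiF n B) {p : ℕ}
    (h1 : ∀ b, ok n p b → iv n p b ∉ B) (h2 : ∀ a, ok n a (p + 1) → iv n a (p + 1) ∉ B) :
    Gf B p = 0 ∧ Gf B (p + 1) = 0 := by
  have key := flat_zero hB h1 h2
  unfold Gf
  rw [Finset.card_eq_zero, Finset.card_eq_zero, Finset.eq_empty_iff_forall_notMem,
    Finset.eq_empty_iff_forall_notMem]
  constructor
  · intro I hI
    obtain ⟨c, d, o', rfl⟩ := hB.cal I (Finset.mem_filter.1 hI).1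
    rw [mem_AtP o'.2.1] at hI
    exact key _ c d le_rfl o' hI.1 hI.2.1 hI.2.2
  · intro I hI
    obtain ⟨c, d, o', rfl⟩ := hB.cal I (Finset.mem_filter.1 hI).1
    rw [mem_AtP o'.2.1] at hI
    have hc : c ≠ p := by rintro rfl; exact h1 d o' hI.1
    exact key _ c d le_rfl o' hI.1 (by omega) (by omega)

theorem Gf_walk {n : ℕ} {B : Finset (Finset (Fin n))} (hB : PhiF n B) : IsW n (Gf B) := by
  refine ⟨?_, ?_, ?_⟩
  · simp [Gf, AtP]
  · unfold Gf
    rw [Finset.card_eq_zero, Finset.eq_empty_iff_forall_notMem]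
    intro I hI
    obtain ⟨s, _, hs⟩ := (Finset.mem_filter.1 hI).2
    have := s.isLt
    omega
  · intro p hp
    by_cases h1 : ∀ b, ok n p b → iv n p b ∉ B
    · by_cases h2 : ∀ a, ok n a (p + 1) → iv n a (p + 1) ∉ B
      · exact Or.inr (Or.inr (Gf_flat hB h1 h2))
      · push Not at h2
        obtain ⟨a, o, m⟩ := h2
        exact Or.inr (Or.inl (Gf_down hB o m))
    · push Not at h1
      obtain ⟨b, o, m⟩ := h1
      exact Or.inl (Gf_up hB o m)

theorem val_of_mem {n : ℕ} {B : Finset (Finset (Fin n))} (hB : PhiF n B) {a b : ℕ} (o : ok n a b)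
    (m : iv n a b ∈ B) : Val n (Gf B) a b := by
  have o' := o
  obtain ⟨x1, x2, x3⟩ := o
  refine ⟨x1, x2, ?_, ?_⟩
  · unfold Gf
    congr 1
    apply Finset.Subset.antisymm
    · apply AtP_sub hB
      intro c d o2 m2 h1 h2
      have := hB.tri a b c d o' o2 m m2
      omega
    · apply AtP_sub hB
      intro c d o2 m2 h1 h2
      have := hB.tri a b c d o' o2 m m2
      omega
  · intro p h1 h2
    unfold Gf
    apply Finset.card_lt_card
    refine ⟨AtP_sub hB ?_, ?_⟩
    · intro c d o2 m2 h1 h2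
      have := hB.tri a b c d o' o2 m m2
      omega
    · intro hsub
      have := hsub ((mem_AtP x2).2 ⟨m, h1, h2⟩)
      rw [mem_AtP x2] at this
      omega

theorem mem_of_val {n : ℕ} {B : Finset (Finset (Fin n))} (hB : PhiF n B) {a b : ℕ}
    (v : Val n (Gf B) a b) : iv n a b ∈ B := by
  have hup : Gf B a < Gf B (a + 1) := v.2.2.2 _ (by omega) (by have := v.1; omega)
  have : ∃ d, ok n a d ∧ iv n a d ∈ B := by
    by_contra hcon
    push Not at hcon
    have hsub : AtP B (a + 1) ⊆ AtP B a := by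
      apply AtP_sub hB
      intro c d o m h1 h2
      have : c ≠ a := by rintro rfl; exact hcon d o m
      omega
    have := Finset.card_le_card hsub
    unfold Gf at hup
    omega
  obtain ⟨d, o, m⟩ := this
  have v' := val_of_mem hB o m
  obtain ⟨y1, y2, y3⟩ := o
  have : b = d := by
    have := v.1
    rcases Val_tri v v' with h | h | h | h | h <;> omega
  rw [this]; exact m

theorem mem_iff {n : ℕ} {B : Finset (Finset (Fin n))} (hB : PhiF n B) (I : Finset (Fin n)) :
    I ∈ B ↔ ∃ a b, Val n (Gf B) a b ∧ I = iv n a b := by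
  constructor
  · intro hI
    obtain ⟨a, b, o, rfl⟩ := hB.cal I hI
    exact ⟨a, b, val_of_mem hB o hI, rfl⟩
  · rintro ⟨a, b, v, rfl⟩
    exact mem_of_val hB v

/-- The set attached to a height walk. -/
noncomputable def Bof (n : ℕ) (g : ℕ → ℕ) : Finset (Finset (Fin n)) := by
  classical
  exact Finset.univ.filter (fun I => ∃ a b, Val n g a b ∧ I = iv n a b)

theorem mem_Bof {n : ℕ} {g : ℕ → ℕ} {I : Finset (Fin n)} :
    I ∈ Bof n g ↔ ∃ a b, Val n g a b ∧ I = iv n a b := by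
  simp [Bof]

theorem iv_mem_Bof {n : ℕ} {g : ℕ → ℕ} {a b : ℕ} (h : a + 2 ≤ b) (h' : b ≤ n + 1) :
    iv n a b ∈ Bof n g ↔ Val n g a b := by
  rw [mem_Bof]
  constructor
  · rintro ⟨c, d, v, e⟩
    obtain ⟨rfl, rfl⟩ := iv_inj h h' v.1 v.2.1 e
    exact v
  · intro v
    exact ⟨a, b, v, rfl⟩

theorem val_ok {n : ℕ} {g : ℕ → ℕ} (st : ∀ p ≤ n, Rst (g p) (g (p + 1))) {a b : ℕ}
    (v : Val n g a b) : ok n a b := by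
  have := Val_parity st v b (by have := v.1; omega) le_rfl
  obtain ⟨h1, h2, h3, h4⟩ := v
  exact ⟨h1, h2, by omega⟩

theorem Bof_phi {n : ℕ} {g : ℕ → ℕ} (st : ∀ p ≤ n, Rst (g p) (g (p + 1))) :
    Bof n g ∈ phiSet (padj n) := by
  classical
  refine ⟨?_, ?_, ?_⟩
  · intro I hI
    obtain ⟨a, b, v, rfl⟩ := mem_Bof.1 hI
    exact cal_iff.2 ⟨a, b, val_ok st v, rfl⟩
  · intro I hI I' hI'
    obtain ⟨a, b, v, rfl⟩ := mem_Bof.1 hI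
    obtain ⟨c, d, v', rfl⟩ := mem_Bof.1 hI'
    rw [spade_iff v.1 v.2.1 v'.1 v'.2.1, prec_iff v.1 v.2.1 v'.1 v'.2.1,
      prec_iff v'.1 v'.2.1 v.1 v.2.1]
    rcases Val_tri v v' with ⟨rfl, rfl⟩ | h | h | h | h
    · exact Or.inl rfl
    all_goals tauto
  · intro I hI
    obtain ⟨a, b, v, rfl⟩ := mem_Bof.1 hI
    let T : Finset (Finset (Fin n)) := (Bof n g).filter
      (fun J => ∃ c d, Val n g c d ∧ J = iv n c d ∧ g c = g a + 1 ∧ a < c ∧ d < b)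
    have hT : ∀ J ∈ T, ∃ c d, Val n g c d ∧ J = iv n c d ∧ g c = g a + 1 ∧ a < c ∧ d < b :=
      fun J hJ => (Finset.mem_filter.1 hJ).2
    refine ⟨T.card, fun j => (T.equivFin.symm j).1, ?_, ?_, ?_⟩
    · intro j
      have hj := (T.equivFin.symm j).2
      refine ⟨(Finset.mem_filter.1 hj).1, ?_⟩
      obtain ⟨c, d, v', e, h1, h2, h3⟩ := hT _ hj
      beta_reduce
      rw [e, prec_iff v'.1 v'.2.1 v.1 v.2.1]
      exact ⟨h2, h3⟩
    · intro j j' hne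
      have hne' : (T.equivFin.symm j).1 ≠ (T.equivFin.symm j').1 := by
        intro e
        exact hne (T.equivFin.symm.injective (Subtype.ext e))
      obtain ⟨c, d, v1, e, h1, h2, h3⟩ := hT _ (T.equivFin.symm j).2
      obtain ⟨c', d', v1', e', h1', h2', h3'⟩ := hT _ (T.equivFin.symm j').2
      simp only
      rw [e, e']
      rw [Finset.disjoint_left]
      intro s hs hs'
      rw [mem_iv] at hs hs'
      rcases Val_tri v1 v1' with ⟨rfl, rfl⟩ | h | h | h | h
      · exact hne' (e.trans e'.symm)
      all_goals omega
    · intro s hs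
      rw [iev_iff (val_ok st v)] at hs
      obtain ⟨s1, s2, s3⟩ := hs
      have hpar := Val_parity st v ((s : ℕ) + 1) (by omega) (by omega)
      have hgt := v.2.2.2 _ s1 s2
      obtain ⟨x1, x2, x3, x4⟩ := v
      obtain ⟨c, c1, c2, c3, c4⟩ := ivt_left st (a := a) (m := g a + 1) (by omega) ((s : ℕ) + 1)
        (by omega) (by omega) (by omega)
      obtain ⟨d, d1, d2, d3, d4⟩ := ivt_right st (b := b) (m := g a + 1) x2 (by omega)
        (p := (s : ℕ) + 1) (by omega) (by omega)
      have hca : c ≠ a := by rintro rfl; omega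
      have hdb : d ≠ b := by rintro rfl; omega
      have v' : Val n g c d := by
        refine ⟨by omega, by omega, by omega, ?_⟩
        intro p p1 p2
        rw [c3]
        rcases Nat.lt_or_ge p ((s : ℕ) + 1) with h | h
        · exact c4 p p1 (by omega)
        · exact d4 p h p2
      have hmem : iv n c d ∈ T := by
        refine Finset.mem_filter.2 ⟨mem_Bof.2 ⟨c, d, v', rfl⟩, c, d, v', rfl, c3, by omega, by omega⟩
      rw [Set.mem_iUnion]
      refine ⟨T.equivFin ⟨_, hmem⟩, ?_⟩
      simp only [Equiv.symm_apply_apply, Finset.mem_coe, mem_iv]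
      omega

theorem Bof_Gf {n : ℕ} {g : ℕ → ℕ} (hg : IsW n g) : ∀ p ≤ n + 1, Gf (Bof n g) p = g p := by
  intro p hp
  have hex : ∀ m, m < g p → ∃ c d, Val n g c d ∧ c < p ∧ p < d ∧ g c = m := by
    intro m hm
    obtain ⟨c, c1, c2, c3, c4⟩ := ivt_left hg.st (a := 0) (m := m) (by rw [hg.g0]; omega) p
        (by omega) (by omega) (by omega)
    obtain ⟨d, d1, d2, d3, d4⟩ := ivt_right hg.st (b := n + 1) (m := m) le_rfl
      (by rw [hg.gn]; omega) (p := p) (by omega) (by omega)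
    refine ⟨c, d, ⟨by omega, by omega, by omega, ?_⟩, c2, d1, c3⟩
    intro q p1 p2
    rw [c3]
    rcases Nat.lt_or_ge q p with h | h
    · exact c4 q p1 (by omega)
    · exact d4 q h p2
  choose! c d h1 h2 h3 h4 using hex
  symm
  unfold Gf
  rw [← Finset.card_range (g p)]
  refine Finset.card_bij (fun m _ => iv n (c m) (d m)) ?_ ?_ ?_
  · intro m hm
    rw [Finset.mem_range] at hm
    have v := h1 m hm
    rw [mem_AtP v.2.1, iv_mem_Bof v.1 v.2.1]
    exact ⟨v, h2 m hm, h3 m hm⟩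
  · intro m hm m' hm' e
    rw [Finset.mem_range] at hm hm'
    have v := h1 m hm
    have v' := h1 m' hm'
    have := (iv_inj v.1 v.2.1 v'.1 v'.2.1 e).1
    rw [← h4 m hm, ← h4 m' hm', this]
  · intro I hI
    obtain ⟨a, b, v, rfl⟩ := mem_Bof.1 (Finset.mem_filter.1 hI).1
    rw [mem_AtP v.2.1] at hI
    have hlt := v.2.2.2 p hI.2.1 hI.2.2
    refine ⟨g a, Finset.mem_range.2 hlt, ?_⟩
    have v' := h1 _ hlt
    have e4 := h4 _ hlt
    have e2 := h2 _ hlt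
    have e3 := h3 _ hlt
    have : a = c (g a) ∧ b = d (g a) := by
      rcases Val_tri v v' with h | h | h | h | h
      · exact h
      all_goals omega
    rw [← this.1, ← this.2]

end PathPerfect
namespace PathPerfect

/-- The standard basis. -/
def eb (n : ℕ) (s : Fin n) : Fin n → ZMod 2 := Pi.single s 1

/-- Evaluation at a position (zero outside `1..n`), as a linear form. -/
noncomputable def hatL (n p : ℕ) : (Fin n → ZMod 2) →ₗ[ZMod 2] ZMod 2 :=
  if h : 0 < p ∧ p - 1 < n then LinearMap.proj ⟨p - 1, h.2⟩ else 0

theorem hatL_succ {n : ℕ} (v : Fin n → ZMod 2) (s : Fin n) : hatL n ((s : ℕ) + 1) v = v s := by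
  unfold hatL
  rw [dif_pos ⟨by omega, by simp⟩]
  simp

theorem hatL_out {n p : ℕ} (v : Fin n → ZMod 2) (h : p = 0 ∨ n < p) : hatL n p v = 0 := by
  unfold hatL
  rw [dif_neg (by omega)]
  simp

theorem eSum_apply {n : ℕ} (I : Finset (Fin n)) (s : Fin n) :
    eSum (eb n) I s = if s ∈ I then 1 else 0 := by
  simp [eSum, eb, Finset.sum_apply, Pi.single_apply]

theorem hatL_iv {n a b p : ℕ} (hb : b ≤ n + 1) :
    hatL n p (eSum (eb n) (iv n a b)) = if a < p ∧ p < b then 1 else 0 := by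
  by_cases h : p = 0 ∨ n < p
  · rw [hatL_out _ h, if_neg (by omega)]
  · obtain ⟨s, rfl⟩ := exists_fin (n := n) (p := p) (by omega) (by omega)
    rw [hatL_succ, eSum_apply]
    simp only [mem_iv]

theorem epsB_apply {n : ℕ} (B : Finset (Finset (Fin n))) (s : Fin n) :
    epsB (eb n) B s = Ep (gs B s) := by
  simp [epsB, eb, Ep, Finset.sum_apply, Pi.single_apply]

theorem hatL_eps {n : ℕ} {B : Finset (Finset (Fin n))} (hB : PhiF n B) {p : ℕ} (hp : p ≤ n + 1) :
    hatL n p (epsB (eb n) B) = Ep (Gf B p) := by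
  have hw := Gf_walk hB
  by_cases h : p = 0 ∨ n < p
  · rw [hatL_out _ h]
    rcases h with rfl | h
    · rw [hw.g0, Ep_zero]
    · obtain rfl : p = n + 1 := by omega
      rw [hw.gn, Ep_zero]
  · obtain ⟨s, rfl⟩ := exists_fin (n := n) (p := p) (by omega) (by omega)
    rw [hatL_succ, epsB_apply, Gf_gs]

theorem hat_ext {n : ℕ} {u v : Fin n → ZMod 2} (h : ∀ p ≤ n + 1, hatL n p u = hatL n p v) :
    u = v := by
  funext s
  rw [← hatL_succ u s, ← hatL_succ v s]
  exact h _ (by have := s.isLt; omega)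

theorem CC_of_mem {n : ℕ} {B : Finset (Finset (Fin n))} (hB : PhiF n B) {v : Fin n → ZMod 2}
    (hv : v ∈ LB (eb n) B) : CC n (Gf B) (fun p => hatL n p v) := by
  intro i j hij hj hg hq
  unfold LB at hv
  induction hv using Submodule.span_induction with
  | mem x hx =>
    obtain ⟨I, hI, rfl⟩ := hx
    obtain ⟨a, b, ⟨x1, x2, x3, x4⟩, rfl⟩ := (mem_iff hB I).1 hI
    simp only [hatL_iv x2]
    have k1 := hq a
    have k2 := hq b
    have k3 := x4 i
    have k4 := x4 j
    congr 1
    apply propext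
    omega
  | zero => simp
  | add x y _ _ hx hy => simp only [map_add] at *; rw [hx, hy]
  | smul c x _ hx => simp only [map_smul] at *; rw [hx]

theorem mem_of_CC {n : ℕ} {B : Finset (Finset (Fin n))} (hB : PhiF n B) {v : Fin n → ZMod 2}
    (hv : CC n (Gf B) (fun p => hatL n p v)) : v ∈ LB (eb n) B := by
  have hw := Gf_walk hB
  have key : ∀ p ≤ n + 1, ∃ u ∈ LB (eb n) B, ∀ q ≤ p, hatL n q u = hatL n q v := by
    intro p
    induction p with
    | zero =>
      intro _
      refine ⟨0, Submodule.zero_mem _, fun q hq => ?_⟩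
      rw [hatL_out _ (by omega), hatL_out _ (by omega)]
    | succ p ih =>
      intro hp
      obtain ⟨u, hu, huv⟩ := ih (by omega)
      have hcu := CC_of_mem hB hu
      by_cases he : hatL n (p + 1) u = hatL n (p + 1) v
      · refine ⟨u, hu, fun q hq => ?_⟩
        rcases Nat.lt_or_ge p q with h | h
        · obtain rfl : q = p + 1 := by omega
          exact he
        · exact huv q h
      · rcases hw.st p (by omega) with h | h | h
        · obtain ⟨d, d1, d2, d3, d4⟩ := ivt_right hw.st (b := n + 1) (m := Gf B p) le_rfl
            (by rw [hw.gn]; omega) (p := p + 1) (by omega) (by omega)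
          have hval : Val n (Gf B) p d :=
            ⟨by omega, d2, d3.symm, fun q q1 q2 => d4 q (by omega) q2⟩
          refine ⟨u + eSum (eb n) (iv n p d), Submodule.add_mem _ hu (Submodule.subset_span
            ⟨_, mem_of_val hB hval, rfl⟩), fun q hq => ?_⟩
          rw [map_add, hatL_iv d2]
          rcases Nat.lt_or_ge p q with h | h
          · obtain rfl : q = p + 1 := by omega
            rw [if_pos (by omega)]
            exact zmod2_ne he
          · rw [if_neg (by omega), add_zero]
            exact huv q h
        · exfalso
          obtain ⟨c, -, c2, c3, c4⟩ := ivt_left hw.st (a := 0) (m := Gf B (p + 1))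
            (by rw [hw.g0]; omega) p (by omega) (by omega) (by omega)
          have hq : ∀ q, c ≤ q → q ≤ p + 1 → Gf B c ≤ Gf B q := by
            intro q q1 q2
            rcases Nat.lt_or_ge c q with h3 | h3
            · rcases Nat.lt_or_ge p q with h4 | h4
              · obtain rfl : q = p + 1 := by omega
                omega
              · have := c4 q h3 h4
                omega
            · obtain rfl : q = c := by omega
              exact le_rfl
          have e1 := hv c (p + 1) (by omega) hp c3 hq
          have e2 := hcu c (p + 1) (by omega) hp c3 hq
          simp only at e1 e2
          exact he (by rw [← e1, ← e2, huv c (by omega)])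
        · exfalso
          have hq : ∀ q, p ≤ q → q ≤ p + 1 → Gf B p ≤ Gf B q := by
            intro q q1 q2
            omega
          have e1 := hv p (p + 1) (by omega) hp (by omega) hq
          have e2 := hcu p (p + 1) (by omega) hp (by omega) hq
          simp only at e1 e2
          exact he (by rw [← e1, ← e2, huv p (by omega)])
  obtain ⟨u, hu, huv⟩ := key (n + 1) le_rfl
  rw [← hat_ext huv]
  exact hu

theorem eps_mem {n : ℕ} {B : Finset (Finset (Fin n))} (hB : PhiF n B) :
    epsB (eb n) B ∈ LB (eb n) B := by
  apply mem_of_CC hB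
  intro i j hij hj hg _
  simp only
  rw [hatL_eps hB (by omega), hatL_eps hB hj, hg]

theorem interval_mem {n : ℕ} {B : Finset (Finset (Fin n))} (hB : PhiF n B) {a b : ℕ}
    (o : ok n a b) (h : eSum (eb n) (iv n a b) ∈ LB (eb n) B) : iv n a b ∈ B := by
  have hw := Gf_walk hB
  have hc := CC_of_mem hB h
  obtain ⟨o1, o2, o3⟩ := o
  have f : ∀ i j, i ≤ j → j ≤ n + 1 → Gf B i = Gf B j →
      (∀ q, i ≤ q → q ≤ j → Gf B i ≤ Gf B q) → ((a < i ∧ i < b) ↔ (a < j ∧ j < b)) := by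
    intro i j h1 h2 h3 h4
    have := hc i j h1 h2 h3 h4
    simp only [hatL_iv o2] at this
    split_ifs at this with hi hj hj
    · exact ⟨fun _ => hj, fun _ => hi⟩
    · exact absurd this (by decide)
    · exact absurd this (by decide)
    · exact ⟨fun x => absurd x hi, fun x => absurd x hj⟩
  rcases hw.st a (by omega) with hs | hs | hs
  · obtain ⟨d, d1, d2, d3, d4⟩ := ivt_right hw.st (b := n + 1) (m := Gf B a) le_rfl
      (by rw [hw.gn]; omega) (p := a + 1) (by omega) (by omega)
    have hval : Val n (Gf B) a d :=
      ⟨by omega, d2, d3.symm, fun q q1 q2 => d4 q (by omega) q2⟩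
    have f1 := f a d (by omega) d2 d3.symm (by
      intro q q1 q2
      rcases Nat.lt_or_ge q d with h | h
      · rcases Nat.lt_or_ge a q with h' | h'
        · exact (hval.2.2.2 q h' h).le
        · obtain rfl : q = a := by omega
          exact le_rfl
      · obtain rfl : q = d := by omega
        omega)
    have hd1 : Gf B (d - 1) = Gf B (a + 1) := by
      have h1 := d4 (d - 1) (by omega) (by omega)
      have h2 := hw.st (d - 1) (by omega)
      rw [show d - 1 + 1 = d by omega] at h2
      unfold Rst at h2
      omega
    have f2 := f (a + 1) (d - 1) (by omega) (by omega) hd1.symm (by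
      intro q q1 q2
      have := d4 q q1 (by omega)
      omega)
    have : d = b := by omega
    rw [← this]
    exact mem_of_val hB hval
  · exfalso
    obtain ⟨c, -, c2, c3, c4⟩ := ivt_left hw.st (a := 0) (m := Gf B (a + 1))
            (by rw [hw.g0]; omega) a (by omega) (by omega) (by omega)
    have f1 := f c (a + 1) (by omega) (by omega) c3 (by
      intro q q1 q2
      rcases Nat.lt_or_ge c q with h3 | h3
      · rcases Nat.lt_or_ge a q with h4 | h4
        · obtain rfl : q = a + 1 := by omega
          omega
        · have := c4 q h3 h4
          omega
      · obtain rfl : q = c := by omega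
        exact le_rfl)
    omega
  · exfalso
    have f1 := f a (a + 1) (by omega) (by omega) (by omega) (by intro q _ _; omega)
    omega

theorem lin_indep {n : ℕ} {B : Finset (Finset (Fin n))} (hB : PhiF n B) :
    LinearIndependent (ZMod 2) (fun I : {I : Finset (Fin n) // I ∈ B} => eSum (eb n) I.1) := by
  have hex : ∀ I : {I : Finset (Fin n) // I ∈ B}, ∃ a b, ok n a b ∧ I.1 = iv n a b :=
    fun I => hB.cal I.1 I.2
  choose a b o e using hex
  refine LinearIndependent.of_pairwise_dual_eq_zero_one _
    (fun I => hatL n (a I + 1) - hatL n (a I)) ?_ ?_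
  · intro I J hIJ
    have m1 := I.2
    have m2 := J.2
    rw [e I] at m1
    rw [e J] at m2
    have t := hB.tri _ _ _ _ (o I) (o J) m1 m2
    have hne : ¬ (a I = a J ∧ b I = b J) := by
      rintro ⟨h1, h2⟩
      apply hIJ
      apply Subtype.ext
      rw [e I, e J, h1, h2]
    have o1 := (o I).1
    have o2 := (o J).1
    simp only [LinearMap.sub_apply]
    rw [e J, hatL_iv (o J).2.1, hatL_iv (o J).2.1, sub_eq_zero]
    congr 1
    apply propext
    omega
  · intro I
    have o1 := (o I).1
    simp only [LinearMap.sub_apply]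
    rw [e I, hatL_iv (o I).2.1, hatL_iv (o I).2.1, if_pos (by omega), if_neg (by omega), sub_zero]

theorem perfect (n : ℕ) : IsPerfect (padj n) (eb n) := by
  refine ⟨?_, ?_, ⟨?_, ?_, ?_⟩, ?_⟩
  · intro B hB
    have hF := phi_facts hB
    refine ⟨lin_indep hF, fun I hI => ⟨fun h => ?_, fun h => ?_⟩⟩
    · obtain ⟨a, b, o, rfl⟩ := cal_iff.1 hI
      exact interval_mem hF o h
    · exact Submodule.subset_span ⟨I, h, rfl⟩
  · intro B hB
    exact eps_mem (phi_facts hB)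
  · intro B hB
    exact Set.mem_biUnion hB (eps_mem (phi_facts hB))
  · intro B hB B' hB' he
    have hF := phi_facts hB
    have hF' := phi_facts hB'
    have hu := walk_unique (Gf_walk hF) (Gf_walk hF') (fun p hp => by
      rw [← hatL_eps hF hp, ← hatL_eps hF' hp, he])
    have hval : ∀ a b, Val n (Gf B) a b ↔ Val n (Gf B') a b := by
      intro a b
      unfold Val
      refine and_congr_right fun h1 => and_congr_right fun h2 => ?_
      rw [hu a (by omega), hu b h2]
      refine and_congr_right fun _ => ?_
      refine forall_congr' fun p => forall_congr' fun _ => forall_congr' fun h => ?_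
      rw [hu p (by omega)]
    ext I
    rw [mem_iff hF, mem_iff hF']
    simp only [hval]
  · intro v hv
    rw [Set.mem_iUnion₂] at hv
    obtain ⟨B, hB, hv⟩ := hv
    have hF := phi_facts hB
    have hw := Gf_walk hF
    obtain ⟨h, h0, hst, hE⟩ := walk_ex (fun p => hatL n p v) (hatL_out _ (Or.inl rfl))
    have hc := CC_of_mem hF hv
    have hle := walk_le hw h0 (fun p _ => hst p) (by
      intro i j h1 h2 h3 h4
      simp only [hE]
      exact hc i j h1 h2 h3 h4)
    have hh : IsW n h := ⟨h0, by have := hle (n + 1) le_rfl; rw [hw.gn] at this; omega,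
      fun p _ => hst p⟩
    have hphi := Bof_phi hh.st
    refine ⟨Bof n h, hphi, ?_⟩
    apply hat_ext
    intro p hp
    rw [hatL_eps (phi_facts hphi) hp, Bof_Gf hh p hp, hE]
  · intro B hB B' hB' he s
    have hF := phi_facts hB
    have hF' := phi_facts hB'
    have hw' := Gf_walk hF'
    have hc := CC_of_mem hF he
    rw [Gf_gs, Gf_gs]
    refine walk_le (Gf_walk hF) hw'.g0 hw'.st ?_ _ (by have := s.isLt; omega)
    intro i j h1 h2 h3 h4
    have := hc i j h1 h2 h3 h4
    simp only at this ⊢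
    rwa [hatL_eps hF' (by omega), hatL_eps hF' h2] at this

end PathPerfect
/-- the path of type `A_{N-1}` (`N ≥ 3` odd) with `V = F^S`,
`e_s` the standard basis, is perfect. -/
theorem statement0 (N : ℕ) (hN : 3 ≤ N) (hodd : Odd N) :
    IsPerfect (fun i j : Fin (N - 1) => (i : ℕ) + 1 = (j : ℕ) ∨ (j : ℕ) + 1 = (i : ℕ))
      (fun s : Fin (N - 1) => (Pi.single s 1 : Fin (N - 1) → ZMod 2)) := by
  exact PathPerfect.perfect (N - 1)
end

section
/- Let N ≥ 3 be odd, S = Z/NZ, V = F^S with standard basis (e_s)_{s in S}, and <.,.> the alternating bilinear form determined by <e_i,e_j> = 1 iff j = i+1 or j = i−1 in Z/NZ, so that (S,E) is a cycle of length N (affine type A_{N−1}) and the radical of <.,.> is F·e_S. Then the triple (V,<.,.>,(e_s)) is perfect. -/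
namespace Cyc

set_option linter.unusedSectionVars false

variable {N : ℕ} [NeZero N]

/-- The arc `{a, a+1, …, a+l-1}`. -/
def arc (a : ZMod N) (l : ℕ) : Finset (ZMod N) :=
  (Finset.range l).image (fun i : ℕ => a + (i : ZMod N))

lemma mem_arc {a : ZMod N} {l : ℕ} {x : ZMod N} :
    x ∈ arc a l ↔ ∃ i, i < l ∧ x = a + (i : ZMod N) := by
  simp only [arc, Finset.mem_image, Finset.mem_range]
  constructor
  · rintro ⟨i, h, rfl⟩; exact ⟨i, h, rfl⟩
  · rintro ⟨i, h, rfl⟩; exact ⟨i, h, rfl⟩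

lemma cast_inj {i j : ℕ} (hi : i < N) (hj : j < N) (h : (i : ZMod N) = j) : i = j := by
  rw [ZMod.natCast_eq_natCast_iff'] at h
  rwa [Nat.mod_eq_of_lt hi, Nat.mod_eq_of_lt hj] at h

lemma add_inj' {a : ZMod N} {i j : ℕ} (hi : i < N) (hj : j < N)
    (h : a + (i : ZMod N) = a + j) : i = j :=
  cast_inj hi hj (add_left_cancel h)

lemma mem_arc_add {a : ZMod N} {l i : ℕ} (hl : l ≤ N) (hi : i < N) :
    a + (i : ZMod N) ∈ arc a l ↔ i < l := by
  rw [mem_arc]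
  constructor
  · rintro ⟨j, hj, h⟩
    have := add_inj' hi (by omega) h
    omega
  · intro h; exact ⟨i, h, rfl⟩

lemma card_arc {a : ZMod N} {l : ℕ} (hl : l ≤ N) : (arc a l).card = l := by
  rw [arc, Finset.card_image_of_injOn, Finset.card_range]
  intro i hi j hj h
  simp only [Finset.coe_range, Set.mem_Iio] at hi hj
  exact add_inj' (by omega) (by omega) h

lemma arc_union (a : ZMod N) (l l' : ℕ) :
    arc a l ∪ arc (a + l) l' = arc a (l + l') := by
  ext x
  simp only [Finset.mem_union, mem_arc]
  constructor
  · rintro (⟨i, h, rfl⟩ | ⟨i, h, rfl⟩)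
    · exact ⟨i, by omega, rfl⟩
    · exact ⟨l + i, by omega, by push_cast; ring⟩
  · rintro ⟨i, h, rfl⟩
    by_cases hi : i < l
    · exact Or.inl ⟨i, hi, rfl⟩
    · refine Or.inr ⟨i - l, by omega, ?_⟩
      rw [Nat.cast_sub (by omega)]; ring

lemma arc_disj {a : ZMod N} {l l' : ℕ} (h : l + l' ≤ N) :
    Disjoint (arc a l) (arc (a + l) l') := by
  rw [Finset.disjoint_left]
  intro x hx hx'
  rw [mem_arc] at hx hx'
  obtain ⟨i, hi, rfl⟩ := hx
  obtain ⟨j, hj, h2⟩ := hx'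
  have : a + (i : ZMod N) = a + ((l + j : ℕ) : ZMod N) := by rw [h2]; push_cast; ring
  have := add_inj' (by omega) (by omega) this
  omega

lemma conn_arc (a : ZMod N) (l : ℕ) : ConnOn (cadj N) (arc a l) := by
  have key : ∀ i, i < l →
      Relation.ReflTransGen (fun x y => x ∈ arc a l ∧ y ∈ arc a l ∧ cadj N x y) a (a + (i : ZMod N))
      ∧ Relation.ReflTransGen (fun x y => x ∈ arc a l ∧ y ∈ arc a l ∧ cadj N x y)
        (a + (i : ZMod N)) a := by
    intro i
    induction i with
    | zero => intro _; simp [Relation.ReflTransGen.refl]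
    | succ i ih =>
      intro hi
      obtain ⟨h1, h2⟩ := ih (by omega)
      have m1 : a + (i : ZMod N) ∈ arc a l := mem_arc.2 ⟨i, by omega, rfl⟩
      have m2 : a + ((i + 1 : ℕ) : ZMod N) ∈ arc a l := mem_arc.2 ⟨i + 1, by omega, rfl⟩
      have e : a + ((i + 1 : ℕ) : ZMod N) = a + (i : ZMod N) + 1 := by push_cast; ring
      exact ⟨h1.tail ⟨m1, m2, Or.inl e⟩, Relation.ReflTransGen.head ⟨m2, m1, Or.inr e⟩ h2⟩
  intro s hs t ht
  obtain ⟨i, hi, rfl⟩ := mem_arc.1 hs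
  obtain ⟨j, hj, rfl⟩ := mem_arc.1 ht
  exact (key i hi).2.trans (key j hj).1

/-- An arc meeting `X` and not crossing its boundary lies in `X`. -/
lemma arc_sub {a : ZMod N} {l : ℕ} {X : Set (ZMod N)}
    (h : ∀ s, s ∈ arc a l → s + 1 ∈ arc a l → (s ∈ X ↔ s + 1 ∈ X))
    {x : ZMod N} (hx : x ∈ arc a l) (hX : x ∈ X) : ∀ y ∈ arc a l, y ∈ X := by
  have key : ∀ i, i < l → (a + (i : ZMod N) ∈ X ↔ a ∈ X) := by
    intro i
    induction i with
    | zero => intro _; simp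
    | succ i ih =>
      intro hi
      rw [← ih (by omega)]
      have m1 : a + (i : ZMod N) ∈ arc a l := mem_arc.2 ⟨i, by omega, rfl⟩
      have m2 : a + ((i + 1 : ℕ) : ZMod N) ∈ arc a l := mem_arc.2 ⟨i + 1, by omega, rfl⟩
      have e : a + ((i + 1 : ℕ) : ZMod N) = a + (i : ZMod N) + 1 := by push_cast; ring
      rw [e] at m2 ⊢
      exact (h _ m1 m2).symm
  intro y hy
  obtain ⟨i, hi, rfl⟩ := mem_arc.1 hx
  obtain ⟨j, hj, rfl⟩ := mem_arc.1 hy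
  exact (key j hj).2 ((key i hi).1 hX)

lemma end_not_mem {a : ZMod N} {l : ℕ} (hl : l < N) : a + (l : ZMod N) ∉ arc a l := by
  rw [mem_arc_add hl.le hl]; omega

lemma pred_not_mem {a : ZMod N} {l : ℕ} (hl : l < N) : a - 1 ∉ arc a l := by
  have : a - 1 = a + ((N - 1 : ℕ) : ZMod N) := by
    rw [Nat.cast_sub (by omega)]; simp; ring
  rw [this, mem_arc_add hl.le (by omega)]; omega

lemma bd_end {a : ZMod N} {l : ℕ} {s : ZMod N} (h : s ∈ arc a l) (h' : s + 1 ∉ arc a l) :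
    s + 1 = a + (l : ZMod N) := by
  obtain ⟨i, hi, rfl⟩ := mem_arc.1 h
  have e : a + (i : ZMod N) + 1 = a + ((i + 1 : ℕ) : ZMod N) := by push_cast; ring
  by_cases hh : i + 1 < l
  · exact absurd (mem_arc.2 ⟨i + 1, hh, e⟩) h'
  · rw [e, show i + 1 = l by omega]

lemma bd_start {a : ZMod N} {l : ℕ} {s : ZMod N} (h : s ∉ arc a l) (h' : s + 1 ∈ arc a l) :
    s + 1 = a := by
  obtain ⟨i, hi, h2⟩ := mem_arc.1 h'
  cases i with
  | zero => simpa using h2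
  | succ i =>
    refine absurd (mem_arc.2 ⟨i, by omega, ?_⟩) h
    push_cast at h2
    have := congrArg (· - 1) h2
    simp only [add_sub_cancel_right] at this
    rw [this]; ring

/-- Criterion for disconnectedness. -/
lemma not_conn {X : Finset (ZMod N)} (Y : Set (ZMod N))
    (hY : ∀ s, s ∈ X → s + 1 ∈ X → (s ∈ Y ↔ s + 1 ∈ Y)) {x y : ZMod N}
    (hx : x ∈ X) (hy : y ∈ X) (hxY : x ∈ Y) (hyY : y ∉ Y) : ¬ ConnOn (cadj N) X := by
  intro h
  have := h x hx y hy
  have key : y ∈ Y := by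
    clear hyY hy
    induction this with
    | refl => exact hxY
    | tail _ hbc ih =>
      obtain ⟨h1, h2, h3 | h3⟩ := hbc
      · subst h3; exact (hY _ h1 h2).1 ih
      · subst h3; exact (hY _ h2 h1).2 ih
  exact hyY key

lemma calI1_arc {a : ZMod N} {l : ℕ} (hl : Odd l) (h : l + 2 ≤ N) :
    CalI1 (cadj N) (arc a l) := by
  obtain ⟨k, rfl⟩ := hl
  refine ⟨⟨2 * k, fun i => a + ((i : ℕ) : ZMod N), ?_, ?_, ?_⟩, ?_⟩
  · intro i j hij
    exact Fin.ext (add_inj' (by omega) (by omega) hij)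
  · ext x
    simp only [mem_arc, Finset.mem_image, Finset.mem_univ, true_and]
    constructor
    · rintro ⟨i, hi, rfl⟩; exact ⟨⟨i, hi⟩, rfl⟩
    · rintro ⟨i, rfl⟩; exact ⟨i, i.2, rfl⟩
  · intro i j
    have hi := i.2
    have hj := j.2
    show (a + ((j : ℕ) : ZMod N) = a + ((i : ℕ) : ZMod N) + 1 ∨
      a + ((i : ℕ) : ZMod N) = a + ((j : ℕ) : ZMod N) + 1) ↔ _
    constructor
    · rintro (h1 | h1)
      · left
        refine add_inj' (a := a) (by omega) (by omega) ?_
        rw [h1]; push_cast; ring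
      · right
        refine add_inj' (a := a) (by omega) (by omega) ?_
        rw [h1]; push_cast; ring
    · rintro (h1 | h1)
      · left; rw [← h1]; push_cast; ring
      · right; rw [← h1]; push_cast; ring
  · rw [card_arc (by omega)]; exact ⟨k, rfl⟩

lemma exists_arc (hN : 3 ≤ N) (hodd : Odd N) {I : Finset (ZMod N)} (h : CalI1 (cadj N) I) :
    ∃ a l, Odd l ∧ l + 2 ≤ N ∧ I = arc a l := by
  obtain ⟨⟨m, f, hf, rfl, hadj⟩, hc⟩ := h
  rw [Finset.card_image_of_injective _ hf, Finset.card_univ, Fintype.card_fin] at hc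
  have hle : m + 1 ≤ N := by
    have := Fintype.card_le_of_injective f hf
    simpa [ZMod.card] using this
  let g : ℕ → ZMod N := fun i => if h : i < m + 1 then f ⟨i, h⟩ else 0
  have hg : ∀ i (h : i < m + 1), g i = f ⟨i, h⟩ := fun i h => dif_pos h
  have hstep : ∀ i, i + 1 < m + 1 → g (i + 1) = g i + 1 ∨ g i = g (i + 1) + 1 := by
    intro i hi
    have := (hadj ⟨i, by omega⟩ ⟨i + 1, hi⟩).2 (Or.inl rfl)
    rw [hg i (by omega), hg (i + 1) hi]
    exact this
  have hne : ∀ i, i + 2 < m + 1 → g (i + 2) ≠ g i := by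
    intro i hi h
    rw [hg i (by omega), hg (i + 2) hi] at h
    have := congrArg Fin.val (hf h)
    simp at this
  have hdir : (∀ i, i < m + 1 → g i = g 0 + (i : ZMod N)) ∨
      (∀ i, i < m + 1 → g 0 = g i + (i : ZMod N)) := by
    by_cases hm : m = 0
    · left; intro i hi
      have : i = 0 := by omega
      subst this; simp
    rcases hstep 0 (by omega) with h0 | h0
    · left
      have : ∀ i, i + 1 < m + 1 → g (i + 1) = g i + 1 := by
        intro i
        induction i with
        | zero => intro _; exact h0
        | succ i ih =>
          intro hi
          rcases hstep (i + 1) hi with h | h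
          · exact h
          · exfalso
            rw [ih (by omega)] at h
            exact hne i hi (add_right_cancel h).symm
      intro i
      induction i with
      | zero => intro _; simp
      | succ i ih =>
        intro hi
        rw [this i hi, ih (by omega)]; push_cast; ring
    · right
      have : ∀ i, i + 1 < m + 1 → g i = g (i + 1) + 1 := by
        intro i
        induction i with
        | zero => intro _; exact h0
        | succ i ih =>
          intro hi
          rcases hstep (i + 1) hi with h | h
          · exfalso
            exact hne i hi (by rw [h, ← ih (by omega)])
          · exact h
      intro i
      induction i with
      | zero => intro _; simp
      | succ i ih =>
        intro hi
        rw [ih (by omega), this i hi]; push_cast; ring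
  have hlt : m + 1 ≠ N := by
    intro hmN
    have hm0 : ((m : ℕ) : ZMod N) + 1 = 0 := by
      have : ((m + 1 : ℕ) : ZMod N) = 0 := by rw [hmN]; simp
      simpa using this
    have hadj0 : cadj N (f ⟨0, by omega⟩) (f ⟨m, by omega⟩) := by
      rw [← hg 0, ← hg m]
      rcases hdir with h | h
      · right
        rw [h m (by omega), add_assoc, hm0, add_zero]
      · left
        rw [h m (by omega), add_assoc, hm0, add_zero]
    rw [hadj] at hadj0
    simp at hadj0
    omega
  have hlen : m + 1 + 2 ≤ N := by
    obtain ⟨p, hp⟩ := hc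
    obtain ⟨q, hq⟩ := hodd
    omega
  rcases hdir with h | h
  · refine ⟨g 0, m + 1, hc, hlen, ?_⟩
    ext x
    simp only [mem_arc, Finset.mem_image, Finset.mem_univ, true_and]
    constructor
    · rintro ⟨i, rfl⟩
      exact ⟨i, i.2, by rw [← h i i.2, hg i i.2]⟩
    · rintro ⟨i, hi, rfl⟩
      exact ⟨⟨i, hi⟩, by rw [← h i hi, hg i hi]⟩
  · refine ⟨g m, m + 1, hc, hlen, ?_⟩
    have h' : ∀ i, i < m + 1 → g i = g m + ((m - i : ℕ) : ZMod N) := by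
      intro i hi
      have e1 := h i hi
      have e2 := h m (by omega)
      rw [Nat.cast_sub (by omega)]
      rw [e1] at e2
      linear_combination e2
    ext x
    simp only [mem_arc, Finset.mem_image, Finset.mem_univ, true_and]
    constructor
    · rintro ⟨i, rfl⟩
      exact ⟨m - i, by omega, by rw [← h' i i.2, hg i i.2]⟩
    · rintro ⟨i, hi, rfl⟩
      refine ⟨⟨m - i, by omega⟩, ?_⟩
      rw [← hg (m - i), h' (m - i) (by omega)]
      congr 2; omega

/-- members of `B` containing `s`. -/
def ch (B : Finset (Finset (ZMod N))) (s : ZMod N) : Finset (Finset (ZMod N)) :=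
  B.filter (fun I => s ∈ I)

lemma mem_ch {B : Finset (Finset (ZMod N))} {s : ZMod N} {I : Finset (ZMod N)} :
    I ∈ ch B s ↔ I ∈ B ∧ s ∈ I := by simp [ch]

lemma gs_eq (B : Finset (Finset (ZMod N))) (s : ZMod N) : gs B s = (ch B s).card := rfl

lemma prec_end {I I' : Finset (ZMod N)} {a a' : ZMod N} {l l' : ℕ} (hI : I = arc a l)
    (hI' : I' = arc a' l') (hl : l < N) (hl' : l' < N) (h : a + (l : ZMod N) = a' + l') :
    ¬ Prec (cadj N) I I' := by
  rintro ⟨h1, h2⟩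
  have hc := Finset.card_lt_card h1
  rw [hI, hI', card_arc hl.le, card_arc hl'.le] at hc
  apply h2
  have ea : a = a' + ((l' - l : ℕ) : ZMod N) := by
    rw [Nat.cast_sub hc.le]; linear_combination h
  have e : I' = arc a' (l' - l) ∪ I := by
    rw [hI, ea, arc_union, hI']; congr 1; omega
  have d : Disjoint (arc a' (l' - l)) I := by
    rw [hI, ea]; exact arc_disj (by omega)
  rw [e, Finset.union_sdiff_cancel_right d]
  exact conn_arc _ _

lemma prec_start {I I' : Finset (ZMod N)} {a : ZMod N} {l l' : ℕ} (hI : I = arc a l)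
    (hI' : I' = arc a l') (hl : l < N) (hl' : l' < N) :
    ¬ Prec (cadj N) I I' := by
  rintro ⟨h1, h2⟩
  have hc := Finset.card_lt_card h1
  rw [hI, hI', card_arc hl.le, card_arc hl'.le] at hc
  apply h2
  have e : I' = I ∪ arc (a + l) (l' - l) := by
    rw [hI, arc_union, hI']; congr 1; omega
  have d : Disjoint I (arc (a + l) (l' - l)) := by
    rw [hI]; exact arc_disj (by omega)
  rw [e, Finset.union_sdiff_cancel_left d]
  exact conn_arc _ _

section phi

variable {B : Finset (Finset (ZMod N))}

lemma phi_arc (hN : 3 ≤ N) (hodd : Odd N) (hB : B ∈ phiSet (cadj N)) {I : Finset (ZMod N)}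
    (hI : I ∈ B) : ∃ a l, Odd l ∧ l + 2 ≤ N ∧ I = arc a l :=
  exists_arc hN hodd (hB.1 I hI)

lemma nested (hB : B ∈ phiSet (cadj N)) {I J : Finset (ZMod N)} (hI : I ∈ B) (hJ : J ∈ B)
    {x : ZMod N} (hx : x ∈ I) (hx' : x ∈ J) : I ⊆ J ∨ J ⊆ I := by
  rcases hB.2.1 I hI J hJ with h | h | h | h
  · exact Or.inl h.subset
  · exact absurd (Finset.mem_inter.2 ⟨hx, hx'⟩) (by rw [h.1]; simp)
  · exact Or.inl h.1.subset
  · exact Or.inr h.1.subset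

lemma end_unique (hN : 3 ≤ N) (hodd : Odd N) (hB : B ∈ phiSet (cadj N))
    {I J : Finset (ZMod N)} (hI : I ∈ B) (hJ : J ∈ B) {s : ZMod N}
    (h1 : s ∈ I) (h2 : s + 1 ∉ I) (h3 : s ∈ J) (h4 : s + 1 ∉ J) : I = J := by
  obtain ⟨a, l, ho, hl, e⟩ := phi_arc hN hodd hB hI
  obtain ⟨a', l', ho', hl', e'⟩ := phi_arc hN hodd hB hJ
  have q1 := bd_end (e ▸ h1) (e ▸ h2)
  have q2 := bd_end (e' ▸ h3) (e' ▸ h4)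
  rcases hB.2.1 I hI J hJ with h | h | h | h
  · exact h
  · exact absurd (Finset.mem_inter.2 ⟨h1, h3⟩) (by rw [h.1]; simp)
  · exact absurd h (prec_end e e' (by omega) (by omega) (q1.symm.trans q2))
  · exact absurd h (prec_end e' e (by omega) (by omega) (q2.symm.trans q1))

lemma start_unique (hN : 3 ≤ N) (hodd : Odd N) (hB : B ∈ phiSet (cadj N))
    {I J : Finset (ZMod N)} (hI : I ∈ B) (hJ : J ∈ B) {s : ZMod N}
    (h1 : s ∉ I) (h2 : s + 1 ∈ I) (h3 : s ∉ J) (h4 : s + 1 ∈ J) : I = J := by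
  obtain ⟨a, l, ho, hl, e⟩ := phi_arc hN hodd hB hI
  obtain ⟨a', l', ho', hl', e'⟩ := phi_arc hN hodd hB hJ
  have q1 := bd_start (e ▸ h1) (e ▸ h2)
  have q2 := bd_start (e' ▸ h3) (e' ▸ h4)
  have q : a' = a := q2.symm.trans q1
  subst q
  rcases hB.2.1 I hI J hJ with h | h | h | h
  · exact h
  · exact absurd (Finset.mem_inter.2 ⟨h2, h4⟩) (by rw [h.1]; simp)
  · exact absurd h (prec_start e e' (by omega) (by omega))
  · exact absurd h (prec_start e' e (by omega) (by omega))

lemma end_start (hN : 3 ≤ N) (hodd : Odd N) (hB : B ∈ phiSet (cadj N))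
    {I J : Finset (ZMod N)} (hI : I ∈ B) (hJ : J ∈ B) {s : ZMod N}
    (h1 : s ∈ I) (h2 : s + 1 ∉ I) (h3 : s ∉ J) (h4 : s + 1 ∈ J) : False := by
  obtain ⟨a, l, ho, hl, e⟩ := phi_arc hN hodd hB hI
  obtain ⟨a', l', ho', hl', e'⟩ := phi_arc hN hodd hB hJ
  have q1 := bd_end (e ▸ h1) (e ▸ h2)
  have q2 := bd_start (e' ▸ h3) (e' ▸ h4)
  rcases hB.2.1 I hI J hJ with h | h | h | h
  · exact h3 (h ▸ h1)
  · apply h.2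
    rw [e, e', ← q2, q1, arc_union]
    exact conn_arc _ _
  · exact h3 (h.1.subset h1)
  · exact h2 (h.1.subset h4)

lemma ch_start (hN : 3 ≤ N) (hodd : Odd N) (hB : B ∈ phiSet (cadj N))
    {J : Finset (ZMod N)} (hJ : J ∈ B) {s : ZMod N} (h3 : s ∉ J) (h4 : s + 1 ∈ J) :
    J ∉ ch B s ∧ ch B (s + 1) = insert J (ch B s) := by
  refine ⟨fun h => h3 (mem_ch.1 h).2, ?_⟩
  ext I
  simp only [Finset.mem_insert, mem_ch]
  constructor
  · rintro ⟨hI, h⟩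
    by_cases hs : s ∈ I
    · exact Or.inr ⟨hI, hs⟩
    · exact Or.inl (start_unique hN hodd hB hI hJ hs h h3 h4)
  · rintro (rfl | ⟨hI, h⟩)
    · exact ⟨hJ, h4⟩
    · refine ⟨hI, ?_⟩
      by_contra hs
      exact end_start hN hodd hB hI hJ h hs h3 h4

lemma ch_end (hN : 3 ≤ N) (hodd : Odd N) (hB : B ∈ phiSet (cadj N))
    {J : Finset (ZMod N)} (hJ : J ∈ B) {s : ZMod N} (h3 : s ∈ J) (h4 : s + 1 ∉ J) :
    J ∉ ch B (s + 1) ∧ ch B s = insert J (ch B (s + 1)) := by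
  refine ⟨fun h => h4 (mem_ch.1 h).2, ?_⟩
  ext I
  simp only [Finset.mem_insert, mem_ch]
  constructor
  · rintro ⟨hI, h⟩
    by_cases hs : s + 1 ∈ I
    · exact Or.inr ⟨hI, hs⟩
    · exact Or.inl (end_unique hN hodd hB hI hJ h hs h3 h4)
  · rintro (rfl | ⟨hI, h⟩)
    · exact ⟨hJ, h3⟩
    · refine ⟨hI, ?_⟩
      by_contra hs
      exact end_start hN hodd hB hJ hI h3 h4 hs h

lemma spade_arcs {a : ZMod N} {p q : ℕ} (hp : 0 < p) (hq : 0 < q) (h : p + 1 + q < N) :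
    Spade (cadj N) (arc a p) (arc (a + ((p + 1 : ℕ) : ZMod N)) q) := by
  have hd : Disjoint (arc a p) (arc (a + ((p + 1 : ℕ) : ZMod N)) q) :=
    Disjoint.mono_left (fun x hx => by
      obtain ⟨i, hi, rfl⟩ := mem_arc.1 hx
      exact mem_arc.2 ⟨i, by omega, rfl⟩) (arc_disj (l := p + 1) (by omega))
  refine ⟨Finset.disjoint_iff_inter_eq_empty.1 hd, ?_⟩
  have hmem : ∀ i, i < N → (a + (i : ZMod N) ∈ arc a p ∪ arc (a + ((p + 1 : ℕ) : ZMod N)) q ↔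
      i < p ∨ (p + 1 ≤ i ∧ i < p + 1 + q)) := by
    intro i hi
    rw [Finset.mem_union, mem_arc_add (by omega) hi, mem_arc]
    constructor
    · rintro (h1 | ⟨j, hj, h1⟩)
      · exact Or.inl h1
      · right
        have : a + (i : ZMod N) = a + ((p + 1 + j : ℕ) : ZMod N) := by rw [h1]; push_cast; ring
        have := add_inj' hi (by omega) this
        omega
    · rintro (h1 | h1)
      · exact Or.inl h1
      · refine Or.inr ⟨i - (p + 1), by omega, ?_⟩
        rw [Nat.cast_sub (by omega)]; ring
  refine not_conn (↑(arc a p)) ?_ (x := a + ((0 : ℕ) : ZMod N))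
    (y := a + ((p + 1 : ℕ) : ZMod N)) ?_ ?_ ?_ ?_
  · intro s hs hs1
    have hs2 : ∃ i, i < p + 1 + q ∧ s = a + (i : ZMod N) := by
      rcases Finset.mem_union.1 hs with h1 | h1
      · obtain ⟨i, hi, e⟩ := mem_arc.1 h1
        exact ⟨i, by omega, e⟩
      · obtain ⟨i, hi, e⟩ := mem_arc.1 h1
        exact ⟨p + 1 + i, by omega, by rw [e]; push_cast; ring⟩
    obtain ⟨i, hi, rfl⟩ := hs2
    have e : a + (i : ZMod N) + 1 = a + ((i + 1 : ℕ) : ZMod N) := by push_cast; ring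
    rw [e] at hs1 ⊢
    rw [hmem i (by omega)] at hs
    rw [hmem (i + 1) (by omega)] at hs1
    rw [Finset.mem_coe, Finset.mem_coe, mem_arc_add (by omega) (by omega),
      mem_arc_add (by omega) (by omega)]
    omega
  · rw [hmem 0 (by omega)]; omega
  · rw [hmem (p + 1) (by omega)]; omega
  · rw [Finset.mem_coe, mem_arc_add (by omega) (by omega)]; exact hp
  · rw [Finset.mem_coe, mem_arc_add (by omega) (by omega)]; omega

lemma erase_arc {a : ZMod N} {l p : ℕ} (hl : l < N) (hp : p < l) :
    (arc a l).erase (a + (p : ZMod N)) =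
      arc a p ∪ arc (a + ((p + 1 : ℕ) : ZMod N)) (l - p - 1) := by
  ext x
  simp only [Finset.mem_erase, Finset.mem_union, mem_arc]
  constructor
  · rintro ⟨h1, i, hi, rfl⟩
    rcases lt_trichotomy i p with h | h | h
    · exact Or.inl ⟨i, h, rfl⟩
    · exact absurd (by rw [h]) h1
    · refine Or.inr ⟨i - (p + 1), by omega, ?_⟩
      rw [Nat.cast_sub (by omega)]; ring
  · rintro (⟨i, hi, rfl⟩ | ⟨i, hi, rfl⟩)
    · refine ⟨fun h => ?_, i, by omega, rfl⟩
      have := add_inj' (by omega) (by omega) h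
      omega
    · have e : a + ((p + 1 : ℕ) : ZMod N) + (i : ZMod N) = a + ((p + 1 + i : ℕ) : ZMod N) := by
        push_cast; ring
      rw [e]
      refine ⟨fun h => ?_, p + 1 + i, by omega, rfl⟩
      have := add_inj' (by omega) (by omega) h
      omega

lemma mem_Iev_arc {a : ZMod N} {l p : ℕ} (ho : Odd l) (hl : l + 2 ≤ N) (hp : p < l)
    (hpo : Odd p) : a + (p : ZMod N) ∈ Iev (cadj N) (arc a l) := by
  obtain ⟨k, hk⟩ := ho
  obtain ⟨r, hr⟩ := hpo
  refine ⟨(mem_arc_add (by omega) (by omega)).2 hp, arc a p,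
    arc (a + ((p + 1 : ℕ) : ZMod N)) (l - p - 1), calI1_arc ⟨r, hr⟩ (by omega),
    calI1_arc ⟨k - r - 1, by omega⟩ (by omega), spade_arcs (by omega) (by omega) (by omega),
    erase_arc (by omega) hp⟩

lemma ch_flat (hN : 3 ≤ N) (hodd : Odd N) (hB : B ∈ phiSet (cadj N)) {s : ZMod N}
    (h : ∀ I ∈ B, (s ∈ I ↔ s + 1 ∈ I)) : ch B s = ∅ := by
  by_contra hne
  obtain ⟨I, hI, hmin⟩ := Finset.exists_min_image (ch B s) Finset.card
    (Finset.nonempty_iff_ne_empty.2 hne)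
  obtain ⟨hIB, hsI⟩ := mem_ch.1 hI
  have hs1 := (h I hIB).1 hsI
  obtain ⟨a, l, ho, hl, e⟩ := phi_arc hN hodd hB hIB
  have hev : s ∈ Iev (cadj N) I ∨ s + 1 ∈ Iev (cadj N) I := by
    rw [e] at hsI hs1
    obtain ⟨i, hi, e1⟩ := mem_arc.1 hsI
    have e2 : s + 1 = a + ((i + 1 : ℕ) : ZMod N) := by rw [e1]; push_cast; ring
    rw [e2, mem_arc_add (by omega) (by omega)] at hs1
    rcases Nat.even_or_odd i with hi' | hi'
    · right; rw [e2, e]; exact mem_Iev_arc ho hl hs1 hi'.add_one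
    · left; rw [e1, e]; exact mem_Iev_arc ho hl hi hi'
  obtain ⟨k, f, hf, -, hcov⟩ := hB.2.2 I hIB
  have : ∃ j, s ∈ f j := by
    rcases hev with h1 | h1
    · obtain ⟨j, hj⟩ := Set.mem_iUnion.1 (hcov h1)
      exact ⟨j, hj⟩
    · obtain ⟨j, hj⟩ := Set.mem_iUnion.1 (hcov h1)
      exact ⟨j, (h _ (hf j).1).2 hj⟩
  obtain ⟨j, hj⟩ := this
  have h1 := hmin (f j) (mem_ch.2 ⟨(hf j).1, hj⟩)
  have h2 := Finset.card_lt_card (hf j).2.1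
  omega

/-- The relation between depths at neighbours. -/
def R (a b : ℕ) : Prop := b = a + 1 ∨ a = b + 1 ∨ (a = 0 ∧ b = 0)

/-- trichotomy of steps -/
lemma step_cases (hN : 3 ≤ N) (hodd : Odd N) (hB : B ∈ phiSet (cadj N)) (s : ZMod N) :
    (∃ J ∈ B, s ∉ J ∧ s + 1 ∈ J ∧ J ∉ ch B s ∧ ch B (s + 1) = insert J (ch B s)) ∨
    (∃ J ∈ B, s ∈ J ∧ s + 1 ∉ J ∧ J ∉ ch B (s + 1) ∧ ch B s = insert J (ch B (s + 1))) ∨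
    (ch B s = ∅ ∧ ch B (s + 1) = ∅) := by
  by_cases h : ∀ I ∈ B, (s ∈ I ↔ s + 1 ∈ I)
  · right; right
    have h1 := ch_flat hN hodd hB h
    refine ⟨h1, ?_⟩
    rw [← h1]
    ext I
    simp only [mem_ch]
    constructor
    · rintro ⟨a, b⟩; exact ⟨a, (h I a).2 b⟩
    · rintro ⟨a, b⟩; exact ⟨a, (h I a).1 b⟩
  · push Not at h
    obtain ⟨J, hJ, ⟨h1, h2⟩ | ⟨h1, h2⟩⟩ := h
    · right; left
      exact ⟨J, hJ, h1, h2, ch_end hN hodd hB hJ h1 h2⟩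
    · left
      exact ⟨J, hJ, h1, h2, ch_start hN hodd hB hJ h1 h2⟩

lemma gs_R (hN : 3 ≤ N) (hodd : Odd N) (hB : B ∈ phiSet (cadj N)) (s : ZMod N) :
    R (gs B s) (gs B (s + 1)) := by
  rw [gs_eq, gs_eq]
  rcases step_cases hN hodd hB s with ⟨J, -, -, -, h1, h2⟩ | ⟨J, -, -, -, h1, h2⟩ | ⟨h1, h2⟩
  · left; rw [h2, Finset.card_insert_of_notMem h1]
  · right; left; rw [h2, Finset.card_insert_of_notMem h1]
  · right; right; simp [h1, h2]

end phi

/-- the function `k(k+1)/2 mod 2`. -/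
def hh (k : ℕ) : ZMod 2 := ((k * (k + 1) / 2 : ℕ) : ZMod 2)

lemma hh_succ (k : ℕ) : hh (k + 1) = hh k + ((k + 1 : ℕ) : ZMod 2) := by
  unfold hh
  rw [← Nat.cast_add]
  congr 1
  have : (k + 1) * (k + 1 + 1) = k * (k + 1) + (k + 1) * 2 := by ring
  rw [this, Nat.add_mul_div_right _ _ (by norm_num)]

lemma hh_add4 (k : ℕ) : hh (k + 4) = hh k := by
  rw [hh_succ, hh_succ, hh_succ, hh_succ]
  push_cast
  have : (2 : ZMod 2) = 0 := by decide
  linear_combination (2 * (k : ZMod 2) + 5) * this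

lemma hh_mod (k : ℕ) : hh k = hh (k % 4) := by
  induction k using Nat.strong_induction_on with
  | _ k ih =>
    by_cases h : k < 4
    · rw [Nat.mod_eq_of_lt h]
    · obtain ⟨m, rfl⟩ : ∃ m, k = m + 4 := ⟨k - 4, by omega⟩
      rw [hh_add4, ih m (by omega)]; simp

lemma hh_eq_iff {a b : ℕ} (h : hh a = hh b) : a % 4 = b % 4 ∨ a % 4 + b % 4 = 3 := by
  rw [hh_mod a, hh_mod b] at h
  have ha : a % 4 < 4 := Nat.mod_lt _ (by norm_num)
  have hb : b % 4 < 4 := Nat.mod_lt _ (by norm_num)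
  revert h
  generalize a % 4 = x at *
  generalize b % 4 = y at *
  interval_cases x <;> interval_cases y <;> simp [hh] <;> decide

lemma R_symm {a b : ℕ} (h : R a b) : R b a := by unfold R at *; omega

lemma R_unique {a b c : ℕ} (h1 : R a b) (h2 : R a c) (h : hh b = hh c) : b = c := by
  have := hh_eq_iff h
  unfold R at *
  omega

lemma zmod2_cases (w : ZMod 2) : w = 0 ∨ w = 1 := by revert w; decide

lemma R_exists (a : ℕ) (w : ZMod 2) : ∃ b, R a b ∧ hh b = w ∧ b ≤ a + 1 := by
  cases a with
  | zero =>
    rcases zmod2_cases w with rfl | rfl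
    · exact ⟨0, by unfold R; omega, by simp [hh], by omega⟩
    · exact ⟨1, by unfold R; omega, by simp [hh], by omega⟩
  | succ a =>
    by_cases h : hh a = w
    · exact ⟨a, by unfold R; omega, h, by omega⟩
    · refine ⟨a + 2, by unfold R; omega, ?_, by omega⟩
      have h2 : hh (a + 2) = hh a + 1 := by
        rw [hh_succ, hh_succ]
        push_cast
        have : (2 : ZMod 2) = 0 := by decide
        linear_combination ((a : ZMod 2) + 1) * this
      rw [h2]
      revert h
      generalize hh a = u
      revert u w; decide

/-- transition function -/
noncomputable def T (w : ZMod 2) (a : ℕ) : ℕ := (R_exists a w).choose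

lemma T_R (w : ZMod 2) (a : ℕ) : R a (T w a) := (R_exists a w).choose_spec.1
lemma T_hh (w : ZMod 2) (a : ℕ) : hh (T w a) = w := (R_exists a w).choose_spec.2.1
lemma T_le (w : ZMod 2) (a : ℕ) : T w a ≤ a + 1 := (R_exists a w).choose_spec.2.2

/-- Uniqueness of closed walks on an odd cycle with prescribed image under `hh`. -/
lemma walk_unique (hodd : Odd N) {x y : ZMod N → ℕ} (hx : ∀ s, R (x s) (x (s + 1)))
    (hy : ∀ s, R (y s) (y (s + 1))) (h : ∀ s, hh (x s) = hh (y s)) : x = y := by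
  let L : ℕ → ℕ → ℤ := fun q a => if (a + q) % 2 = 0 then (a : ℤ) else -1 - a
  have hL : ∀ q a b, hh a = hh b → (L q a - L q b) % 4 = 0 := by
    intro q a b hab
    have := hh_eq_iff hab
    simp only [L]
    split_ifs <;> omega
  have hS : ∀ q a b, R a b → L (q + 1) b - L q a = 1 ∨ L (q + 1) b - L q a = -1 := by
    intro q a b hab
    unfold R at hab
    simp only [L]
    split_ifs <;> omega
  funext s
  have key : ∀ n : ℕ, L n (x (s + n)) - L n (y (s + n)) = L 0 (x s) - L 0 (y s) := by
    intro n
    induction n with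
    | zero => simp
    | succ n ih =>
      have e : s + ((n + 1 : ℕ) : ZMod N) = s + n + 1 := by push_cast; ring
      have a1 := hS n _ _ (hx (s + n))
      have a2 := hS n _ _ (hy (s + n))
      have a3 := hL n _ _ (h (s + n))
      have a4 := hL (n + 1) _ _ (h (s + n + 1))
      rw [e, ← ih]
      omega
  have := key N
  simp only [CharP.cast_eq_zero, add_zero] at this
  obtain ⟨k, hk⟩ := hodd
  simp only [L] at this
  have h0 := hh_eq_iff (h s)
  split_ifs at this <;> omega

lemma walk_zero (hodd : Odd N) {x : ZMod N → ℕ} (hx : ∀ s, R (x s) (x (s + 1))) :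
    ∃ s, x s = 0 := by
  by_contra hne
  push Not at hne
  have key : ∀ n : ℕ, (x (0 + n)) % 2 = (x 0 + n) % 2 := by
    intro n
    induction n with
    | zero => simp
    | succ n ih =>
      have e : (0 : ZMod N) + ((n + 1 : ℕ) : ZMod N) = 0 + n + 1 := by push_cast; ring
      have h1 := hx (0 + n)
      have h2 := hne (0 + n)
      rw [e]
      unfold R at h1
      omega
  have := key N
  simp only [CharP.cast_eq_zero, add_zero] at this
  obtain ⟨k, hk⟩ := hodd
  omega

/-! ### Level arcs of a walk -/

/-- `I` is a component of `{g ≥ k}`. -/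
def Lev (g : ZMod N → ℕ) (k : ℕ) (I : Finset (ZMod N)) : Prop :=
  1 ≤ k ∧ ∃ a l, Odd l ∧ l + 2 ≤ N ∧ I = arc a l ∧ (∀ x ∈ I, k ≤ g x) ∧
    g (a - 1) + 1 = k ∧ g (a + l) + 1 = k

section lev
variable {g : ZMod N → ℕ}

lemma Lev.bd1 {k : ℕ} {I : Finset (ZMod N)} (h : Lev g k I) {s : ZMod N} (h1 : s ∈ I)
    (h2 : s + 1 ∉ I) : g (s + 1) + 1 = k := by
  obtain ⟨-, a, l, ho, hl, e, -, -, h3⟩ := h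
  rw [bd_end (e ▸ h1) (e ▸ h2), h3]

lemma Lev.bd2 {k : ℕ} {I : Finset (ZMod N)} (h : Lev g k I) {s : ZMod N} (h1 : s ∉ I)
    (h2 : s + 1 ∈ I) : g s + 1 = k := by
  obtain ⟨-, a, l, ho, hl, e, -, h3, -⟩ := h
  have := bd_start (e ▸ h1) (e ▸ h2)
  rw [← h3, ← this]; simp

lemma Lev.le {k : ℕ} {I : Finset (ZMod N)} (h : Lev g k I) {s : ZMod N} (h1 : s ∈ I) :
    k ≤ g s := by
  obtain ⟨-, a, l, ho, hl, e, h3, -⟩ := h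
  exact h3 s h1

lemma Lev.sub {k k' : ℕ} {I I' : Finset (ZMod N)} (h : Lev g k I) (h' : Lev g k' I')
    (hk : k' ≤ k) {x : ZMod N} (hx : x ∈ I) (hx' : x ∈ I') : I ⊆ I' := by
  have hh := h
  obtain ⟨-, a, l, ho, hl, e, -⟩ := h
  intro y hy
  rw [e] at hx hy
  refine arc_sub (X := (I' : Set (ZMod N))) ?_ hx hx' y hy
  intro s hs hs1
  rw [← e] at hs hs1
  have l1 := hh.le hs
  have l2 := hh.le hs1
  constructor
  · intro h1
    by_contra h2
    have := h'.bd1 h1 h2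
    omega
  · intro h1
    by_contra h2
    have := h'.bd2 h2 h1
    omega

lemma Lev.eq {k : ℕ} {I I' : Finset (ZMod N)} (h : Lev g k I) (h' : Lev g k I')
    {x : ZMod N} (hx : x ∈ I) (hx' : x ∈ I') : I = I' :=
  Finset.Subset.antisymm (h.sub h' le_rfl hx hx') (h'.sub h le_rfl hx' hx)

lemma Lev.prec {k k' : ℕ} {I I' : Finset (ZMod N)} (h : Lev g k I) (h' : Lev g k' I')
    (hk : k' < k) {x : ZMod N} (hx : x ∈ I) (hx' : x ∈ I') : Prec (cadj N) I I' := by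
  have hsub := h.sub h' hk.le hx hx'
  obtain ⟨-, a, l, ho, hl, e, -, hs, he⟩ := id h
  obtain ⟨-, a', l', ho', hl', e', -⟩ := id h'
  have hlpos : 0 < l := ho.pos
  have ha : a ∈ I := by rw [e]; exact mem_arc.2 ⟨0, hlpos, by simp⟩
  have hb : a + ((l - 1 : ℕ) : ZMod N) ∈ I := by rw [e]; exact mem_arc.2 ⟨l - 1, by omega, rfl⟩
  have eb : a + (l : ZMod N) = a + ((l - 1 : ℕ) : ZMod N) + 1 := by
    rw [Nat.cast_sub (by omega)]; push_cast; ring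
  have ha1 : a - 1 ∉ I := by rw [e]; exact pred_not_mem (by omega)
  have hb1 : a + (l : ZMod N) ∉ I := by rw [e]; exact end_not_mem (by omega)
  have ha2 : a - 1 ∈ I' := by
    by_contra hc
    have := h'.bd2 hc (by rw [sub_add_cancel]; exact hsub ha)
    omega
  have hb2 : a + (l : ZMod N) ∈ I' := by
    by_contra hc
    rw [eb] at hc
    have := h'.bd1 (hsub hb) hc
    rw [← eb] at this
    omega
  refine ⟨⟨hsub, fun hc => ha1 (hc ha2)⟩, ?_⟩
  -- positions in I'
  obtain ⟨p, hp, ep⟩ := mem_arc.1 (e' ▸ ha2 : a - 1 ∈ arc a' l')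
  have ea : a = a' + ((p + 1 : ℕ) : ZMod N) := by
    push_cast; rw [← add_assoc, ← ep]; ring
  have hmemI : ∀ i, i < l → a' + ((p + 1 + i : ℕ) : ZMod N) ∈ I := by
    intro i hi
    rw [e]
    refine mem_arc.2 ⟨i, hi, ?_⟩
    rw [ea]; push_cast; ring
  have hpos : ∀ i, i ≤ l → p + 1 + i < l' := by
    intro i
    induction i with
    | zero =>
      intro _
      have : a' + ((p + 1 : ℕ) : ZMod N) ∈ arc a' l' := by rw [← ea, ← e']; exact hsub ha
      rw [mem_arc_add (by omega) (by omega)] at this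
      exact this
    | succ i ih =>
      intro hi
      have h0 := ih (by omega)
      have : a' + ((p + 1 + (i + 1) : ℕ) : ZMod N) ∈ arc a' l' := by
        rw [← e']
        by_cases hil : i + 1 < l
        · exact hsub (hmemI _ hil)
        · have : i + 1 = l := by omega
          rw [this]
          have e3 : a' + ((p + 1 + l : ℕ) : ZMod N) = a + l := by rw [ea]; push_cast; ring
          rw [e3]; exact hb2
      rw [mem_arc_add (by omega) (by omega)] at this
      exact this
  have hpl := hpos l le_rfl
  refine not_conn (↑(arc a' (p + 1))) ?_ (Finset.mem_sdiff.2 ⟨ha2, ha1⟩)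
    (Finset.mem_sdiff.2 ⟨hb2, hb1⟩) ?_ ?_
  · intro s hs hs1
    rw [Finset.mem_sdiff] at hs hs1
    have hs' := hs.1
    rw [e'] at hs'
    obtain ⟨i, hi, rfl⟩ := mem_arc.1 hs'
    have e4 : a' + (i : ZMod N) + 1 = a' + ((i + 1 : ℕ) : ZMod N) := by push_cast; ring
    rw [Finset.mem_coe, Finset.mem_coe]
    rw [e4] at hs1 ⊢
    rw [mem_arc_add (by omega) (by omega), mem_arc_add (by omega) (by omega)]
    have : i ≠ p := by
      rintro rfl
      exact hs1.2 (by rw [← ea]; exact ha)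
    omega
  · rw [ep, Finset.mem_coe, mem_arc_add (by omega) (by omega)]; omega
  · have e3 : a + (l : ZMod N) = a' + ((p + 1 + l : ℕ) : ZMod N) := by rw [ea]; push_cast; ring
    rw [e3, Finset.mem_coe, mem_arc_add (by omega) (by omega)]; omega

lemma Lev.parity (hg : ∀ s, R (g s) (g (s + 1))) {k : ℕ} (hk : 1 ≤ k) {a : ZMod N} {l : ℕ}
    (h : ∀ x ∈ arc a l, k ≤ g x) (ha : g (a - 1) + 1 = k) :
    ∀ i, i ≤ l → g (a + (i : ZMod N)) % 2 = (k + i) % 2 ∨ (l = 0 ∧ i = 0) := by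
  intro i
  induction i with
  | zero =>
    intro _
    by_cases hl : l = 0
    · right; exact ⟨hl, rfl⟩
    left
    have h1 := hg (a - 1)
    rw [sub_add_cancel] at h1
    have h2 := h a (mem_arc.2 ⟨0, by omega, by simp⟩)
    unfold R at h1
    simp only [Nat.cast_zero, add_zero]
    omega
  | succ i ih =>
    intro hi
    left
    have h0 := ih (by omega)
    have h1 := hg (a + i)
    have h2 := h (a + i) (mem_arc.2 ⟨i, by omega, rfl⟩)
    have e : a + ((i + 1 : ℕ) : ZMod N) = a + i + 1 := by push_cast; ring
    rw [e]
    unfold R at h1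
    omega

lemma Lev.exists (hodd : Odd N) (hg : ∀ s, R (g s) (g (s + 1))) {k : ℕ} (hk : 1 ≤ k)
    {s : ZMod N} (hs : k ≤ g s) : ∃ I, Lev g k I ∧ s ∈ I := by
  obtain ⟨z, hz⟩ := walk_zero hodd hg
  have hL : ∃ i : ℕ, g (s - i) < k := by
    refine ⟨(s - z).val, ?_⟩
    rw [ZMod.natCast_val, ZMod.cast_id]
    simp only [sub_sub_cancel]; omega
  have hR : ∃ i : ℕ, g (s + i) < k := by
    refine ⟨(z - s).val, ?_⟩
    rw [ZMod.natCast_val, ZMod.cast_id]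
    simp only [add_sub_cancel]; omega
  classical
  let i := Nat.find hL
  let j := Nat.find hR
  have hi : g (s - i) < k := Nat.find_spec hL
  have hj : g (s + j) < k := Nat.find_spec hR
  have hi' : ∀ m, m < i → k ≤ g (s - m) := fun m hm => not_lt.1 (Nat.find_min hL hm)
  have hj' : ∀ m, m < j → k ≤ g (s + m) := fun m hm => not_lt.1 (Nat.find_min hR hm)
  clear_value i j
  have hi0 : i ≠ 0 := by rintro rfl; simp at hi; omega
  have hj0 : j ≠ 0 := by rintro rfl; simp at hj; omega
  have hjN : j < N := by
    by_contra hc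
    have h1 : ∃ m, m < N ∧ g (s + m) < k := by
      refine ⟨(z - s).val, ZMod.val_lt _, ?_⟩
      rw [ZMod.natCast_val, ZMod.cast_id]
      simp only [add_sub_cancel]; omega
    obtain ⟨m, hm, h2⟩ := h1
    have := hj' m (by omega)
    omega
  have hij : i + j ≤ N := by
    by_contra hc
    have := hi' (N - j) (by omega)
    rw [Nat.cast_sub (by omega)] at this
    simp only [CharP.cast_eq_zero, zero_sub, sub_neg_eq_add] at this
    omega
  let a : ZMod N := s - ((i - 1 : ℕ) : ZMod N)
  have ea : a = s - ((i - 1 : ℕ) : ZMod N) := rfl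
  clear_value a
  have hall : ∀ x ∈ arc a (i + j - 1), k ≤ g x := by
    intro x hx
    obtain ⟨m, hm, rfl⟩ := mem_arc.1 hx
    by_cases hmi : m < i
    · have : a + (m : ZMod N) = s - ((i - 1 - m : ℕ) : ZMod N) := by
        rw [ea, Nat.cast_sub (show m ≤ i - 1 by omega)]; ring
      rw [this]; exact hi' _ (by omega)
    · have : a + (m : ZMod N) = s + ((m - (i - 1) : ℕ) : ZMod N) := by
        rw [ea, Nat.cast_sub (show i - 1 ≤ m by omega)]; ring
      rw [this]; exact hj' _ (by omega)
  have hsm : s ∈ arc a (i + j - 1) := mem_arc.2 ⟨i - 1, by omega, by rw [ea]; ring⟩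
  have e1 : a - 1 = s - i := by
    rw [ea, Nat.cast_sub (by omega)]; push_cast; ring
  have e2 : a + ((i + j - 1 : ℕ) : ZMod N) = s + j := by
    rw [ea, Nat.cast_sub (by omega), Nat.cast_sub (by omega)]; push_cast; ring
  have g1 : g (a - 1) + 1 = k := by
    have h1 := hg (a - 1)
    rw [sub_add_cancel] at h1
    have h2 := hall a (mem_arc.2 ⟨0, by omega, by simp⟩)
    rw [e1] at h1 ⊢
    unfold R at h1; omega
  have g2 : g (a + ((i + j - 1 : ℕ) : ZMod N)) + 1 = k := by
    have h2 := hall (a + ((i + j - 1 - 1 : ℕ) : ZMod N)) (mem_arc.2 ⟨_, by omega, rfl⟩)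
    have h1 := hg (a + ((i + j - 1 - 1 : ℕ) : ZMod N))
    have e3 : a + ((i + j - 1 - 1 : ℕ) : ZMod N) + 1 = a + ((i + j - 1 : ℕ) : ZMod N) := by
      rw [Nat.cast_sub (show 1 ≤ i + j - 1 by omega)]; push_cast; ring
    rw [e3, e2] at h1
    rw [e2]
    unfold R at h1; omega
  have hpar : (i + j - 1) % 2 = 1 := by
    have := Lev.parity hg hk hall g1 (i + j - 1) le_rfl
    omega
  obtain ⟨q, hq⟩ := hodd
  exact ⟨_, ⟨hk, a, i + j - 1, Nat.odd_iff.2 hpar, by omega, rfl, hall, g1, g2⟩, hsm⟩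

lemma Iev_parity (hN : 3 ≤ N) (hodd : Odd N) {a : ZMod N} {l p : ℕ} (ho : Odd l)
    (hl : l + 2 ≤ N) (hp : p < l) (h : a + (p : ZMod N) ∈ Iev (cadj N) (arc a l)) : Odd p := by
  by_contra hpe
  rw [Nat.not_odd_iff_even] at hpe
  obtain ⟨-, I', I'', h1, h2, h3, h4⟩ := h
  rw [erase_arc (by omega) hp] at h4
  obtain ⟨a1, l1, ho1, hl1, e1⟩ := exists_arc hN hodd h1
  obtain ⟨a2, l2, ho2, hl2, e2⟩ := exists_arc hN hodd h2
  -- no edges between the two parts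
  have hmem : ∀ i, i < N → (a + (i : ZMod N) ∈ arc a p ∪
      arc (a + ((p + 1 : ℕ) : ZMod N)) (l - p - 1) ↔ i < l ∧ i ≠ p) := by
    intro i hi
    rw [← erase_arc (by omega) hp, Finset.mem_erase, mem_arc_add (by omega) hi]
    constructor
    · rintro ⟨q1, q2⟩
      exact ⟨q2, fun h => q1 (by rw [h])⟩
    · rintro ⟨q1, q2⟩
      exact ⟨fun h => q2 (add_inj' hi (by omega) h), q1⟩
  have hedge : ∀ s, s ∈ I' ∪ I'' → s + 1 ∈ I' ∪ I'' → (s ∈ arc a p ↔ s + 1 ∈ arc a p) := by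
    intro s hs hs1
    rw [← h4] at hs hs1
    have hs2 := hs
    rw [← erase_arc (by omega) hp] at hs2
    obtain ⟨i, hi, rfl⟩ := mem_arc.1 (Finset.mem_of_mem_erase hs2)
    have e4 : a + (i : ZMod N) + 1 = a + ((i + 1 : ℕ) : ZMod N) := by push_cast; ring
    rw [e4] at hs1 ⊢
    rw [hmem _ (by omega)] at hs hs1
    rw [mem_arc_add (by omega) (by omega), mem_arc_add (by omega) (by omega)]
    omega
  have hdich : ∀ J, J ⊆ I' ∪ I'' → (∃ b m, J = arc b m) →
      J ⊆ arc a p ∨ Disjoint J (arc a p) := by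
    rintro J hJ ⟨b, m, rfl⟩
    by_cases hd : Disjoint (arc b m) (arc a p)
    · exact Or.inr hd
    · left
      rw [Finset.not_disjoint_iff] at hd
      obtain ⟨x, hx, hx'⟩ := hd
      intro y hy
      exact arc_sub (X := (arc a p : Set (ZMod N)))
        (fun s hs hs1 => hedge s (hJ hs) (hJ hs1)) hx hx' y hy
  have hcap : (I' ∪ I'') ∩ arc a p = arc a p := by
    rw [← h4]; exact Finset.inter_eq_right.2 Finset.subset_union_left
  rw [Finset.union_inter_distrib_right] at hcap
  have hcp : (arc a p).card = p := card_arc (by omega)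
  rcases hdich I' Finset.subset_union_left ⟨a1, l1, e1⟩ with q1 | q1 <;>
  rcases hdich I'' Finset.subset_union_right ⟨a2, l2, e2⟩ with q2 | q2
  · rw [Finset.inter_eq_left.2 q1, Finset.inter_eq_left.2 q2] at hcap
    apply h3.2
    rw [hcap]; exact conn_arc _ _
  · rw [Finset.inter_eq_left.2 q1, Finset.disjoint_iff_inter_eq_empty.1 q2,
      Finset.union_empty] at hcap
    rw [← hcap, e1, card_arc (by omega)] at hcp
    rw [← hcp] at hpe
    exact Nat.not_odd_iff_even.2 hpe ho1
  · rw [Finset.inter_eq_left.2 q2, Finset.disjoint_iff_inter_eq_empty.1 q1,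
      Finset.empty_union] at hcap
    rw [← hcap, e2, card_arc (by omega)] at hcp
    rw [← hcp] at hpe
    exact Nat.not_odd_iff_even.2 hpe ho2
  · rw [Finset.disjoint_iff_inter_eq_empty.1 q1, Finset.disjoint_iff_inter_eq_empty.1 q2,
      Finset.empty_union] at hcap
    apply h3.2
    rw [← h4, ← hcap, Finset.empty_union]; exact conn_arc _ _

open scoped Classical in
/-- The family of all level arcs of `g`. -/
noncomputable def Bg (g : ZMod N → ℕ) : Finset (Finset (ZMod N)) :=
  Finset.univ.filter (fun I => ∃ k, Lev g k I)

lemma mem_Bg {I : Finset (ZMod N)} : I ∈ Bg g ↔ ∃ k, Lev g k I := by simp [Bg]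

lemma Bg_phi (hN : 3 ≤ N) (hodd : Odd N) (hg : ∀ s, R (g s) (g (s + 1))) :
    Bg g ∈ phiSet (cadj N) := by
  refine ⟨?_, ?_, ?_⟩
  · intro I hI
    obtain ⟨k, -, a, l, ho, hl, rfl, -⟩ := mem_Bg.1 hI
    exact calI1_arc ho hl
  · intro I hI I' hI'
    obtain ⟨k, h⟩ := mem_Bg.1 hI
    obtain ⟨k', h'⟩ := mem_Bg.1 hI'
    by_cases hd : ∃ x, x ∈ I ∧ x ∈ I'
    · obtain ⟨x, hx, hx'⟩ := hd
      rcases lt_trichotomy k k' with hk | hk | hk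
      · exact Or.inr (Or.inr (Or.inr (h'.prec h hk hx' hx)))
      · subst hk; exact Or.inl (h.eq h' hx hx')
      · exact Or.inr (Or.inr (Or.inl (h.prec h' hk hx hx')))
    · right; left
      push Not at hd
      have hne : I.Nonempty := by
        obtain ⟨-, a, l, ho, hl, rfl, -⟩ := h
        exact ⟨a, mem_arc.2 ⟨0, ho.pos, by simp⟩⟩
      have hne' : I'.Nonempty := by
        obtain ⟨-, a, l, ho, hl, rfl, -⟩ := h'
        exact ⟨a, mem_arc.2 ⟨0, ho.pos, by simp⟩⟩
      obtain ⟨x, hx⟩ := hne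
      obtain ⟨y, hy⟩ := hne'
      refine ⟨?_, ?_⟩
      · ext z; simp; exact hd z
      · refine not_conn (I : Set (ZMod N)) ?_ (Finset.mem_union_left _ hx)
          (Finset.mem_union_right _ hy) hx (fun hyI => hd y hyI hy)
        intro s hs hs1
        rw [Finset.mem_coe, Finset.mem_coe]
        constructor
        · intro q
          by_contra q1
          have q2 : s + 1 ∈ I' := (Finset.mem_union.1 hs1).resolve_left q1
          have b1 := h.bd1 q q1
          have b2 := h'.bd2 (hd s q) q2
          have b3 := h.le q
          have b4 := h'.le q2
          omega
        · intro q
          by_contra q1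
          have q2 : s ∈ I' := (Finset.mem_union.1 hs).resolve_left q1
          have b1 := h.bd2 q1 q
          have b2 := h'.bd1 q2 (hd _ q)
          have b3 := h.le q
          have b4 := h'.le q2
          omega
  · intro I hI
    classical
    obtain ⟨k, h⟩ := mem_Bg.1 hI
    let C := (Bg g).filter (fun J => Lev g (k + 1) J ∧ ∃ x, x ∈ J ∧ x ∈ I)
    have hC : ∀ J, J ∈ C ↔ J ∈ Bg g ∧ Lev g (k + 1) J ∧ ∃ x, x ∈ J ∧ x ∈ I := by
      intro J; simp [C]
    refine ⟨C.card, fun j => (C.equivFin.symm j).1, ?_, ?_, ?_⟩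
    · intro j
      have hj := (hC _).1 (C.equivFin.symm j).2
      obtain ⟨q1, q2, x, q3, q4⟩ := hj
      exact ⟨q1, q2.prec h (by omega) q3 q4⟩
    · intro j j' hjj
      obtain ⟨-, q2, -⟩ := (hC _).1 (C.equivFin.symm j).2
      obtain ⟨-, q2', -⟩ := (hC _).1 (C.equivFin.symm j').2
      rw [Finset.disjoint_left]
      intro x hx hx'
      exact hjj (C.equivFin.symm.injective (Subtype.ext (q2.eq q2' hx hx')))
    · intro s hs
      have hsI : s ∈ I := hs.1
      obtain ⟨hk, a, l, ho, hl, e, hall, hg1, hg2⟩ := id h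
      rw [e] at hs hall
      obtain ⟨p, hp, rfl⟩ := mem_arc.1 hs.1
      have hpo := Iev_parity hN hodd ho hl hp hs
      have hpar := Lev.parity hg hk hall hg1 p hp.le
      have hge := h.le hsI
      have hge' : k + 1 ≤ g (a + p) := by
        obtain ⟨r, hr⟩ := hpo
        omega
      obtain ⟨J, hJ, hsJ⟩ := Lev.exists hodd hg (by omega) hge'
      have hJC : J ∈ C := (hC J).2 ⟨mem_Bg.2 ⟨_, hJ⟩, hJ, _, hsJ, hsI⟩
      refine Set.mem_iUnion.2 ⟨C.equivFin ⟨J, hJC⟩, ?_⟩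
      simpa using hsJ

lemma gs_Bg (hodd : Odd N) (hg : ∀ s, R (g s) (g (s + 1))) (s : ZMod N) :
    gs (Bg g) s = g s := by
  have hex : ∀ k, ∃ I, 1 ≤ k → k ≤ g s → Lev g k I ∧ s ∈ I := by
    intro k
    by_cases hk : 1 ≤ k ∧ k ≤ g s
    · obtain ⟨I, hI⟩ := Lev.exists hodd hg hk.1 hk.2
      exact ⟨I, fun _ _ => hI⟩
    · exact ⟨∅, fun a b => absurd ⟨a, b⟩ hk⟩
  choose J hJ using hex
  have : ch (Bg g) s = (Finset.Icc 1 (g s)).image J := by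
    ext I
    rw [mem_ch, mem_Bg, Finset.mem_image]
    constructor
    · rintro ⟨⟨k, hk⟩, hs⟩
      have h1 := hk.1
      have h2 := hk.le hs
      exact ⟨k, Finset.mem_Icc.2 ⟨h1, h2⟩, (hJ k h1 h2).1.eq hk (hJ k h1 h2).2 hs⟩
    · rintro ⟨k, hk, rfl⟩
      obtain ⟨h1, h2⟩ := Finset.mem_Icc.1 hk
      exact ⟨⟨k, (hJ k h1 h2).1⟩, (hJ k h1 h2).2⟩
  rw [gs_eq, this, Finset.card_image_of_injOn, Nat.card_Icc]
  · omega
  · intro k hk k' hk' e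
    rw [Finset.mem_coe, Finset.mem_Icc] at hk hk'
    obtain ⟨h1, h2⟩ := hJ k hk.1 hk.2
    obtain ⟨h1', h2'⟩ := hJ k' hk'.1 hk'.2
    rcases lt_trichotomy k k' with q | q | q
    · have := (h1'.prec h1 q h2' h2).1
      rw [e] at this
      exact absurd this (ssubset_irrefl _)
    · exact q
    · have := (h1.prec h1' q h2 h2').1
      rw [e] at this
      exact absurd this (ssubset_irrefl _)

end lev

section main
variable {B : Finset (Finset (ZMod N))}

/-- depth of `I` in `B` -/
def dp (B : Finset (Finset (ZMod N))) (I : Finset (ZMod N)) : ℕ :=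
  (B.filter (fun J => I ⊆ J)).card

lemma dp_le {I : Finset (ZMod N)} {s : ZMod N} (hs : s ∈ I) : dp B I ≤ gs B s := by
  apply Finset.card_le_card
  intro J hJ
  rw [Finset.mem_filter] at hJ ⊢
  exact ⟨hJ.1, hJ.2 hs⟩

lemma dp_eq (hB : B ∈ phiSet (cadj N)) {J : Finset (ZMod N)} {s t : ZMod N}
    (hJ : J ∉ ch B s) (h : ch B t = insert J (ch B s)) :
    dp B J = gs B t ∧ gs B t = gs B s + 1 := by
  have hJt : J ∈ ch B t := by rw [h]; exact Finset.mem_insert_self _ _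
  obtain ⟨hJB, htJ⟩ := mem_ch.1 hJt
  have hsJ : s ∉ J := fun q => hJ (mem_ch.2 ⟨hJB, q⟩)
  constructor
  · refine le_antisymm (dp_le htJ) (Finset.card_le_card ?_)
    intro I hI
    rw [Finset.mem_filter] at hI ⊢
    refine ⟨hI.1, ?_⟩
    have hI' : I ∈ ch B t := mem_ch.2 hI
    rw [h, Finset.mem_insert] at hI'
    rcases hI' with rfl | hI'
    · exact Finset.Subset.refl _
    · rcases nested hB hI.1 hJB hI.2 htJ with q | q
      · exact absurd (q (mem_ch.1 hI').2) hsJ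
      · exact q
  · rw [gs_eq, gs_eq, h, Finset.card_insert_of_notMem hJ]

lemma sub_Bg (hN : 3 ≤ N) (hodd : Odd N) (hB : B ∈ phiSet (cadj N)) : B ⊆ Bg (gs B) := by
  intro I hI
  obtain ⟨a, l, ho, hl, e⟩ := phi_arc hN hodd hB hI
  have hlpos : 0 < l := ho.pos
  have ha : a ∈ I := by rw [e]; exact mem_arc.2 ⟨0, hlpos, by simp⟩
  have hb : a + ((l - 1 : ℕ) : ZMod N) ∈ I := by rw [e]; exact mem_arc.2 ⟨l - 1, by omega, rfl⟩
  have eb : a + ((l - 1 : ℕ) : ZMod N) + 1 = a + (l : ZMod N) := by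
    rw [Nat.cast_sub (by omega)]; push_cast; ring
  have ha1 : a - 1 ∉ I := by rw [e]; exact pred_not_mem (by omega)
  have hb1 : a + (l : ZMod N) ∉ I := by rw [e]; exact end_not_mem (by omega)
  obtain ⟨q1, q2⟩ := ch_start hN hodd hB hI ha1 (by rw [sub_add_cancel]; exact ha)
  obtain ⟨q3, q4⟩ := ch_end hN hodd hB hI hb (by rw [eb]; exact hb1)
  have d1 := dp_eq hB q1 q2
  have d2 := dp_eq hB q3 q4
  rw [sub_add_cancel] at d1
  rw [eb] at d2
  refine mem_Bg.2 ⟨dp B I, by omega, a, l, ho, hl, e, fun x hx => dp_le hx, by omega, by omega⟩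

lemma eq_Bg (hN : 3 ≤ N) (hodd : Odd N) (hB : B ∈ phiSet (cadj N)) : B = Bg (gs B) := by
  refine Finset.Subset.antisymm (sub_Bg hN hodd hB) ?_
  intro I hI
  have hI2 := hI
  obtain ⟨k, -, a, l, ho, hl, e, -⟩ := mem_Bg.1 hI
  have ha : a ∈ I := by rw [e]; exact mem_arc.2 ⟨0, ho.pos, by simp⟩
  have hsub : ch B a ⊆ ch (Bg (gs B)) a := Finset.filter_subset_filter _ (sub_Bg hN hodd hB)
  have hc := gs_Bg hodd (gs_R hN hodd hB) a
  rw [gs_eq, gs_eq] at hc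
  have := Finset.eq_of_subset_of_card_le hsub hc.le
  have hm : I ∈ ch B a := by rw [this]; exact mem_ch.2 ⟨hI2, ha⟩
  exact (mem_ch.1 hm).1

lemma eSum_apply (I : Finset (ZMod N)) (s : ZMod N) :
    eSum (eVec N) I s = if s ∈ I then 1 else 0 := by
  simp only [eSum, eVec, Finset.sum_apply, Pi.single_apply]
  simp

lemma epsB_apply (B : Finset (Finset (ZMod N))) (s : ZMod N) :
    epsB (eVec N) B s = hh (gs B s) := by
  simp only [epsB, eVec, Finset.sum_apply, Pi.smul_apply, Pi.single_apply, smul_eq_mul]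
  simp [hh]

/-- linear combination with coefficients `c`. -/
noncomputable def comb (B : Finset (Finset (ZMod N))) (c : Finset (ZMod N) → ZMod 2) : Vc N :=
  ∑ I ∈ B, c I • eSum (eVec N) I

lemma comb_apply (c : Finset (ZMod N) → ZMod 2) (s : ZMod N) :
    comb B c s = ∑ I ∈ ch B s, c I := by
  simp only [comb, Finset.sum_apply, Pi.smul_apply, eSum_apply, smul_eq_mul, mul_ite, mul_one,
    mul_zero, ch, Finset.sum_filter]

lemma mem_LB {v : Vc N} : v ∈ LB (eVec N) B ↔ ∃ c, v = comb B c := by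
  unfold LB comb
  constructor
  · intro h
    induction h using Submodule.span_induction with
    | mem x hx =>
      obtain ⟨I, hI, rfl⟩ := hx
      refine ⟨fun J => if J = I then 1 else 0, ?_⟩
      simp only [ite_smul, one_smul, zero_smul, Finset.sum_ite_eq']
      rw [if_pos (by simpa using hI)]
    | zero => exact ⟨0, by simp⟩
    | add x y _ _ hx hy =>
      obtain ⟨c, rfl⟩ := hx
      obtain ⟨d, rfl⟩ := hy
      exact ⟨c + d, by simp [add_smul, Finset.sum_add_distrib]⟩
    | smul r x _ hx =>
      obtain ⟨c, rfl⟩ := hx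
      exact ⟨fun I => r * c I, by simp [Finset.smul_sum, mul_smul]⟩
  · rintro ⟨c, rfl⟩
    refine Submodule.sum_mem _ fun I hI => Submodule.smul_mem _ _ (Submodule.subset_span ?_)
    exact ⟨I, hI, rfl⟩

lemma comb_start (hN : 3 ≤ N) (hodd : Odd N) (hB : B ∈ phiSet (cadj N))
    (c : Finset (ZMod N) → ZMod 2) {J : Finset (ZMod N)} (hJ : J ∈ B) {s : ZMod N}
    (h1 : s ∉ J) (h2 : s + 1 ∈ J) : comb B c (s + 1) = c J + comb B c s := by
  obtain ⟨q1, q2⟩ := ch_start hN hodd hB hJ h1 h2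
  rw [comb_apply, comb_apply, q2, Finset.sum_insert q1]

lemma comb_end (hN : 3 ≤ N) (hodd : Odd N) (hB : B ∈ phiSet (cadj N))
    (c : Finset (ZMod N) → ZMod 2) {J : Finset (ZMod N)} (hJ : J ∈ B) {s : ZMod N}
    (h1 : s ∈ J) (h2 : s + 1 ∉ J) : comb B c s = c J + comb B c (s + 1) := by
  obtain ⟨q1, q2⟩ := ch_end hN hodd hB hJ h1 h2
  rw [comb_apply, comb_apply, q2, Finset.sum_insert q1]

lemma comb_zero (hN : 3 ≤ N) (hodd : Odd N) (hB : B ∈ phiSet (cadj N))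
    (c : Finset (ZMod N) → ZMod 2) (h : comb B c = 0) {J : Finset (ZMod N)} (hJ : J ∈ B) :
    c J = 0 := by
  obtain ⟨a, l, ho, hl, e⟩ := phi_arc hN hodd hB hJ
  have ha : a - 1 + 1 ∈ J := by
    rw [e, sub_add_cancel]; exact mem_arc.2 ⟨0, ho.pos, by simp⟩
  have ha1 : a - 1 ∉ J := by rw [e]; exact pred_not_mem (by omega)
  have := comb_start hN hodd hB c hJ ha1 ha
  simpa [h] using this.symm

lemma linInd (hN : 3 ≤ N) (hodd : Odd N) (hB : B ∈ phiSet (cadj N)) :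
    LinearIndependent (ZMod 2) (fun I : {I : Finset (ZMod N) // I ∈ B} => eSum (eVec N) I.1) := by
  rw [Fintype.linearIndependent_iff]
  intro g hg I
  let c : Finset (ZMod N) → ZMod 2 := fun J => if h : J ∈ B then g ⟨J, h⟩ else 0
  have hc : ∀ J : {I : Finset (ZMod N) // I ∈ B}, c J.1 = g J := fun J => dif_pos J.2
  have h0 : comb B c = 0 := by
    rw [← hg, comb, ← Finset.sum_coe_sort]
    exact Finset.sum_congr rfl fun J _ => by rw [hc]
  rw [← hc]
  exact comb_zero hN hodd hB c h0 I.2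

lemma mem_of_eSum (hN : 3 ≤ N) (hodd : Odd N) (hB : B ∈ phiSet (cadj N)) {I : Finset (ZMod N)}
    (hI : CalI1 (cadj N) I) (h : eSum (eVec N) I ∈ LB (eVec N) B) : I ∈ B := by
  obtain ⟨c, hc⟩ := mem_LB.1 h
  obtain ⟨a', l', ho', hl', e'⟩ := exists_arc hN hodd hI
  have hex : ∃ J ∈ B, c J = 1 := by
    by_contra hne
    push Not at hne
    have h0 : comb B c = 0 := by
      refine Finset.sum_eq_zero fun J hJ => ?_
      rw [(zmod2_cases (c J)).resolve_right (hne J hJ), zero_smul]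
    have h1 : eSum (eVec N) I a' = 1 := by
      rw [eSum_apply, if_pos]
      rw [e']; exact mem_arc.2 ⟨0, ho'.pos, by simp⟩
    rw [hc, h0] at h1
    exact absurd h1 (by simp)
  obtain ⟨J, hJ, hcJ⟩ := hex
  obtain ⟨a, l, ho, hl, e⟩ := phi_arc hN hodd hB hJ
  have hlpos : 0 < l := ho.pos
  have ha : a - 1 + 1 ∈ J := by
    rw [e, sub_add_cancel]; exact mem_arc.2 ⟨0, hlpos, by simp⟩
  have ha1 : a - 1 ∉ J := by rw [e]; exact pred_not_mem (by omega)
  have hb : a + ((l - 1 : ℕ) : ZMod N) ∈ J := by rw [e]; exact mem_arc.2 ⟨l - 1, by omega, rfl⟩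
  have eb : a + ((l - 1 : ℕ) : ZMod N) + 1 = a + (l : ZMod N) := by
    rw [Nat.cast_sub (by omega)]; push_cast; ring
  have hb1 : a + ((l - 1 : ℕ) : ZMod N) + 1 ∉ J := by rw [eb, e]; exact end_not_mem (by omega)
  have s1 := comb_start hN hodd hB c hJ ha1 ha
  have s2 := comb_end hN hodd hB c hJ hb hb1
  rw [← hc, hcJ, eSum_apply, eSum_apply] at s1 s2
  have t1 : (a - 1 + 1 ∈ I ∧ a - 1 ∉ I) ∨ (a - 1 + 1 ∉ I ∧ a - 1 ∈ I) := by
    by_cases x : a - 1 + 1 ∈ I <;> by_cases y : a - 1 ∈ I <;> simp only [x, y, if_true, if_false] at s1 ⊢ <;>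
      first | (exfalso; revert s1; decide) | simp
  have t2 : (a + ((l - 1 : ℕ) : ZMod N) ∈ I ∧ a + ((l - 1 : ℕ) : ZMod N) + 1 ∉ I) ∨
      (a + ((l - 1 : ℕ) : ZMod N) ∉ I ∧ a + ((l - 1 : ℕ) : ZMod N) + 1 ∈ I) := by
    by_cases x : a + ((l - 1 : ℕ) : ZMod N) ∈ I <;>
      by_cases y : a + ((l - 1 : ℕ) : ZMod N) + 1 ∈ I <;> simp only [x, y, if_true, if_false] at s2 ⊢ <;>
      first | (exfalso; revert s2; decide) | simp
  rw [e'] at t1 t2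
  have hcast : ∀ m m' : ℕ, m < N → m' < N → a + (m : ZMod N) = a + m' → m = m' :=
    fun m m' x y z => add_inj' x y z
  rcases t1 with ⟨p1, p2⟩ | ⟨p1, p2⟩ <;> rcases t2 with ⟨p3, p4⟩ | ⟨p3, p4⟩
  · have r1 := bd_start p2 p1
    have r2 := bd_end p3 p4
    rw [sub_add_cancel] at r1
    rw [eb, ← r1] at r2
    have := hcast _ _ (by omega) (by omega) r2
    rw [e', ← r1, ← this, ← e]
    exact hJ
  · have r1 := bd_start p2 p1
    have r2 := bd_start p3 p4
    rw [sub_add_cancel] at r1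
    rw [eb, ← r1] at r2
    have := hcast l 0 (by omega) (by omega) (by simpa using r2)
    omega
  · have r1 := bd_end p2 p1
    have r2 := bd_end p3 p4
    rw [sub_add_cancel] at r1
    rw [eb, ← r1] at r2
    have := hcast l 0 (by omega) (by omega) (by simpa using r2)
    omega
  · exfalso
    have r1 := bd_end p2 p1
    have r2 := bd_start p3 p4
    rw [sub_add_cancel] at r1
    rw [eb] at r2
    rw [← r2] at r1
    have r3 : ((l + l' : ℕ) : ZMod N) = 0 := by
      push_cast
      linear_combination -r1
    rw [ZMod.natCast_eq_zero_iff] at r3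
    obtain ⟨m, hm⟩ := r3
    obtain ⟨x, hx⟩ := ho
    obtain ⟨y, hy⟩ := ho'
    obtain ⟨z, hz⟩ := hodd
    have hm2 : m < 2 := by
      by_contra hc2
      have : N * 2 ≤ N * m := Nat.mul_le_mul_left _ (by omega)
      omega
    interval_cases m <;> omega

/-- partial sums along the chain -/
noncomputable def vk (B : Finset (Finset (ZMod N))) (c : Finset (ZMod N) → ZMod 2) (k : ℕ)
    (s : ZMod N) : ZMod 2 := ∑ I ∈ (ch B s).filter (fun I => dp B I ≤ k), c I

/-- the automaton run along the chain -/
noncomputable def Gk (B : Finset (Finset (ZMod N))) (c : Finset (ZMod N) → ZMod 2) (s : ZMod N) :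
    ℕ → ℕ
  | 0 => 0
  | k + 1 => T (vk B c (k + 1) s) (Gk B c s k)

lemma Gk_le (c : Finset (ZMod N) → ZMod 2) (s : ZMod N) (k : ℕ) : Gk B c s k ≤ k := by
  induction k with
  | zero => simp [Gk]
  | succ k ih =>
    have := T_le (vk B c (k + 1) s) (Gk B c s k)
    simp only [Gk]; omega

lemma Gk_R (hB : B ∈ phiSet (cadj N)) (c : Finset (ZMod N) → ZMod 2)
    {J : Finset (ZMod N)} {s t : ZMod N} (hJ : J ∉ ch B s) (h : ch B t = insert J (ch B s)) :
    R (Gk B c s (gs B s)) (Gk B c t (gs B t)) := by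
  obtain ⟨d1, d2⟩ := dp_eq hB hJ h
  have hv : ∀ k, k ≤ gs B s → vk B c k t = vk B c k s := by
    intro k hk
    unfold vk
    rw [h, Finset.filter_insert, if_neg (by omega)]
  have hG : ∀ k, k ≤ gs B s → Gk B c t k = Gk B c s k := by
    intro k
    induction k with
    | zero => intro _; simp [Gk]
    | succ k ih => intro hk; simp only [Gk]; rw [hv _ hk, ih (by omega)]
  rw [d2]
  simp only [Gk]
  rw [hG _ le_rfl]
  exact T_R _ _

lemma exists_walk (hN : 3 ≤ N) (hodd : Odd N) (hB : B ∈ phiSet (cadj N)) {v : Vc N}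
    (hv : v ∈ LB (eVec N) B) :
    ∃ g : ZMod N → ℕ, (∀ s, R (g s) (g (s + 1))) ∧ (∀ s, hh (g s) = v s) ∧
      ∀ s, g s ≤ gs B s := by
  obtain ⟨c, rfl⟩ := mem_LB.1 hv
  refine ⟨fun s => Gk B c s (gs B s), ?_, ?_, fun s => Gk_le c s _⟩
  · intro s
    rcases step_cases hN hodd hB s with ⟨J, -, -, -, h1, h2⟩ | ⟨J, -, -, -, h1, h2⟩ | ⟨h1, h2⟩
    · exact Gk_R hB c h1 h2
    · exact R_symm (Gk_R hB c h1 h2)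
    · right; right
      simp only [gs_eq, h1, h2, Finset.card_empty, Gk, and_self]
  · intro s
    rw [comb_apply]
    by_cases h0 : gs B s = 0
    · have : ch B s = ∅ := Finset.card_eq_zero.1 h0
      simp only [h0, this, Finset.sum_empty, Gk, hh]; simp
    · obtain ⟨m, hm⟩ : ∃ m, gs B s = m + 1 := ⟨gs B s - 1, by omega⟩
      simp only [hm, Gk]
      rw [T_hh, vk, Finset.filter_true_of_mem]
      intro I hI
      rw [← hm]
      exact dp_le (mem_ch.1 hI).2

lemma eps_mem (hB : B ∈ phiSet (cadj N)) : epsB (eVec N) B ∈ LB (eVec N) B := by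
  rw [mem_LB]
  refine ⟨fun I => (dp B I : ZMod 2), ?_⟩
  funext s
  rw [epsB_apply, comb_apply, ← Nat.cast_sum]
  unfold hh
  congr 1
  have e1 : ∀ I ∈ ch B s, dp B I = ((ch B s).filter (fun J => I ⊆ J)).card := by
    intro I hI
    unfold dp
    congr 1
    ext J
    simp only [Finset.mem_filter, mem_ch]
    constructor
    · rintro ⟨a, b⟩; exact ⟨⟨a, b (mem_ch.1 hI).2⟩, b⟩
    · rintro ⟨⟨a, _⟩, b⟩; exact ⟨a, b⟩
  rw [Finset.sum_congr rfl e1]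
  have e2 : ∑ I ∈ ch B s, ((ch B s).filter (fun J => I ⊆ J)).card =
      ∑ I ∈ ch B s, ((ch B s).filter (fun J => J ⊆ I)).card := by
    simp only [Finset.card_filter]
    exact Finset.sum_comm
  have e3 : ∀ I ∈ ch B s, ((ch B s).filter (fun J => I ⊆ J)).card +
      ((ch B s).filter (fun J => J ⊆ I)).card = (ch B s).card + 1 := by
    intro I hI
    rw [← Finset.card_union_add_card_inter]
    congr 1
    · congr 1
      ext J
      simp only [Finset.mem_union, Finset.mem_filter]
      constructor
      · rintro (h | h) <;> exact h.1
      · intro h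
        rcases nested hB (mem_ch.1 hI).1 (mem_ch.1 h).1 (mem_ch.1 hI).2 (mem_ch.1 h).2 with q | q
        · exact Or.inl ⟨h, q⟩
        · exact Or.inr ⟨h, q⟩
    · rw [Finset.card_eq_one]
      refine ⟨I, ?_⟩
      ext J
      simp only [Finset.mem_inter, Finset.mem_filter, Finset.mem_singleton]
      constructor
      · rintro ⟨⟨_, a⟩, ⟨_, b⟩⟩; exact Finset.Subset.antisymm b a
      · rintro rfl; simp [hI]
  have e4 := Finset.sum_congr rfl e3
  rw [Finset.sum_add_distrib, ← e2, Finset.sum_const, smul_eq_mul, ← gs_eq] at e4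
  rw [← e4]
  omega

lemma gs_le (hN : 3 ≤ N) (hodd : Odd N) (hB : B ∈ phiSet (cadj N))
    {B' : Finset (Finset (ZMod N))} (hB' : B' ∈ phiSet (cadj N))
    (h : epsB (eVec N) B' ∈ LB (eVec N) B) (s : ZMod N) : gs B' s ≤ gs B s := by
  obtain ⟨g, h1, h2, h3⟩ := exists_walk hN hodd hB h
  have : g = gs B' := walk_unique hodd h1 (gs_R hN hodd hB') fun s => by rw [h2, epsB_apply]
  rw [← this]; exact h3 s

end main

end Cyc

/-- the cycle of length `N` (`N ≥ 3` odd) with `V = F^S`,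
`e_s` the standard basis, is perfect. -/
theorem statement1 (N : ℕ) [NeZero N] (hN : 3 ≤ N) (hodd : Odd N) :
    IsPerfect (cadj N) (eVec N) := by
  refine ⟨fun B hB => ⟨Cyc.linInd hN hodd hB, fun I hI => ⟨Cyc.mem_of_eSum hN hodd hB hI,
    fun h => Submodule.subset_span ⟨I, h, rfl⟩⟩⟩, fun B hB => Cyc.eps_mem hB, ⟨?_, ?_, ?_⟩,
    fun B hB B' hB' h s => Cyc.gs_le hN hodd hB hB' h s⟩
  · intro B hB
    exact Set.mem_iUnion₂.2 ⟨B, hB, Cyc.eps_mem hB⟩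
  · intro B hB B' hB' h
    have h1 : gs B = gs B' := by
      funext s
      refine le_antisymm (Cyc.gs_le hN hodd hB' hB ?_ s) (Cyc.gs_le hN hodd hB hB' ?_ s)
      · rw [h]; exact Cyc.eps_mem hB'
      · rw [← h]; exact Cyc.eps_mem hB
    rw [Cyc.eq_Bg hN hodd hB, Cyc.eq_Bg hN hodd hB', h1]
  · intro v hv
    obtain ⟨B, hB, hvB⟩ := Set.mem_iUnion₂.1 hv
    obtain ⟨g, h1, h2, -⟩ := Cyc.exists_walk hN hodd hB hvB
    refine ⟨Cyc.Bg g, Cyc.Bg_phi hN hodd h1, ?_⟩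
    funext s
    rw [Cyc.epsB_apply, Cyc.gs_Bg hodd h1, h2]
end
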